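/- Let d ≥ 2, let Ω ⊆ ℝ^d be an open, bounded, nonempty, connected set, and let g ∈ L^∞_+ (i.e. g measurable with 0 < g(x) ≤ 1 for a.e. x ∈ ℝ^d). Then λ₁^g(Ω) > λ₁(Ω) (strict inequality). -/

import Mathlib

open MeasureTheory Metric Set Filter

open scoped Classical ENNReal

noncomputable section

/-- The Rayleigh quotient of `u : ℝ^d → ℝ`. -/
def rayleigh (d : ℕ) (u : EuclideanSpace ℝ (Fin d) → ℝ) : ℝ :=
  (∫ x, ‖gradient u x‖ ^ 2) / (∫ x, (u x) ^ 2)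

/-- A trial function for the Dirichlet eigenvalue on `Ω`: Lipschitz, vanishing outside `Ω`,
and not almost everywhere zero. -/
def IsDirTrial (d : ℕ) (Ω : Set (EuclideanSpace ℝ (Fin d)))
    (u : EuclideanSpace ℝ (Fin d) → ℝ) : Prop :=
  (∃ K, LipschitzWith K u) ∧ (∀ x ∉ Ω, u x = 0) ∧ ¬ (u =ᵐ[volume] fun _ => (0 : ℝ))

/-- The first Dirichlet eigenvalue of `Ω`. -/
def dirichletEV (d : ℕ) (Ω : Set (EuclideanSpace ℝ (Fin d))) : ℝ :=
  sInf { r | ∃ u, IsDirTrial d Ω u ∧ rayleigh d u = r }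

/-- The first twisted eigenvalue of `Ω` with orthogonality constraint `g`. -/
def twistedEV (d : ℕ) (Ω : Set (EuclideanSpace ℝ (Fin d)))
    (g : EuclideanSpace ℝ (Fin d) → ℝ) : ℝ :=
  sInf { r | ∃ u, IsDirTrial d Ω u ∧ (∫ x, u x * g x) = 0 ∧ rayleigh d u = r }

/-- `u` is a minimizer for the first twisted eigenvalue `λ₁^g(Ω)`. -/
def IsTwistedMin (d : ℕ) (Ω : Set (EuclideanSpace ℝ (Fin d)))
    (g u : EuclideanSpace ℝ (Fin d) → ℝ) : Prop :=
  IsDirTrial d Ω u ∧ (∫ x, u x * g x) = 0 ∧ rayleigh d u = twistedEV d Ω g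

/-- The bang-bang function equal to `1` on `Bm` and `α` elsewhere. -/
def chiBang (d : ℕ) (α : ℝ) (Bm : Set (EuclideanSpace ℝ (Fin d))) :
    EuclideanSpace ℝ (Fin d) → ℝ :=
  fun x => if x ∈ Bm then 1 else α

section Poincare

variable {E : Type*} [NormedAddCommGroup E] [InnerProductSpace ℝ E] [FiniteDimensional ℝ E]

theorem LipschitzWith.norm_gradient_le {K : NNReal} {f : E → ℝ} (hf : LipschitzWith K f) (x : E) :
    ‖gradient f x‖ ≤ K := by
  rw [gradient, LinearIsometryEquiv.norm_map]
  exact norm_fderiv_le_of_lipschitz ℝ hf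

theorem sq_integral_Icc_le {g : ℝ → ℝ} (hg : IntervalIntegrable g volume 0 1)
    (hg2 : IntervalIntegrable (fun t => g t ^ 2) volume 0 1) :
    (∫ t in (0:ℝ)..1, g t) ^ 2 ≤ ∫ t in (0:ℝ)..1, g t ^ 2 := by
  set c := ∫ t in (0:ℝ)..1, g t with hc
  have h : 0 ≤ ∫ t in (0:ℝ)..1, (g t - c) ^ 2 :=
    intervalIntegral.integral_nonneg zero_le_one fun t _ => sq_nonneg _
  have h2 : ∫ t in (0:ℝ)..1, (g t - c) ^ 2 = (∫ t in (0:ℝ)..1, g t ^ 2) - c ^ 2 := by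
    have : ∀ t, (g t - c) ^ 2 = g t ^ 2 - (2 * c) * g t + c ^ 2 := fun t => by ring
    simp_rw [this]
    rw [intervalIntegral.integral_add (hg2.sub (hg.const_mul _)) (by simp),
      intervalIntegral.integral_sub hg2 (hg.const_mul _), intervalIntegral.integral_const_mul,
      intervalIntegral.integral_const, ← hc]
    simp; ring
  linarith

variable [MeasurableSpace E] [BorelSpace E]

theorem measurable_gradient (f : E → ℝ) : Measurable (gradient f) :=
  (LinearIsometryEquiv.continuous _).measurable.comp (measurable_fderiv ℝ f)

theorem LipschitzWith.sq_sub_le_lintegral_segment {K : NNReal} {f : E → ℝ}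
    (hf : LipschitzWith K f) (x y : E)
    (hd : ∀ᵐ t ∂(volume.restrict (Ioc (0:ℝ) 1)), DifferentiableAt ℝ f (x + t • (y - x))) :
    ENNReal.ofReal ((f x - f y) ^ 2) ≤ ENNReal.ofReal (‖x - y‖ ^ 2) *
      ∫⁻ t in Ioc (0:ℝ) 1, ENNReal.ofReal (‖gradient f (x + t • (y - x))‖ ^ 2) := by
  have hl : LipschitzWith ‖y - x‖₊ (fun t : ℝ => x + t • (y - x)) :=
    LipschitzWith.of_dist_le_mul fun s t => by
      simp [dist_eq_norm, ← sub_smul, norm_smul, mul_comm]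
  have hfl := hf.comp hl
  set h : ℝ → ℝ := f ∘ fun t : ℝ => x + t • (y - x) with hh
  have hac := (hfl.lipschitzOnWith (s := uIcc 0 1)).absolutelyContinuousOnInterval
  have hftc := hac.integral_deriv_eq_sub
  have hmd : Measurable (deriv h) := measurable_deriv h
  have hbd : ∀ t, ‖deriv h t‖ ≤ K * ‖y - x‖ := fun t => by
    simpa using norm_deriv_le_of_lipschitz hfl (x₀ := t)
  have hI {g : ℝ → ℝ} {C : ℝ} (hm : Measurable g) (hb : ∀ t, ‖g t‖ ≤ C) :
      IntegrableOn g (Ioc 0 1) :=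
    Measure.integrableOn_of_bounded (M := C) (by simp) hm.aestronglyMeasurable
      (ae_of_all _ hb)
  have hmG : Measurable fun t : ℝ => gradient f (x + t • (y - x)) :=
    (measurable_gradient f).comp (by fun_prop)
  have hI1 : IntegrableOn (deriv h) (Ioc 0 1) := hI hmd hbd
  have hI2 : IntegrableOn (fun t => deriv h t ^ 2) (Ioc 0 1) := by
    refine hI (C := (K * ‖y - x‖) ^ 2) (hmd.pow_const 2) fun t => ?_
    rw [norm_pow]
    exact pow_le_pow_left₀ (norm_nonneg _) (hbd t) 2
  have hI3 : IntegrableOn (fun t => ‖gradient f (x + t • (y - x))‖ ^ 2) (Ioc (0:ℝ) 1) := by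
    refine hI (C := (K:ℝ) ^ 2) (hmG.norm.pow_const 2) fun t => ?_
    rw [norm_pow, norm_norm]
    exact pow_le_pow_left₀ (norm_nonneg _) (hf.norm_gradient_le _) 2
  have key : ∫ t in Ioc (0:ℝ) 1, deriv h t ^ 2 ≤
      ∫ t in Ioc (0:ℝ) 1, ‖x - y‖ ^ 2 * ‖gradient f (x + t • (y - x))‖ ^ 2 := by
    refine integral_mono_ae hI2 (hI3.const_mul _) ?_
    filter_upwards [hd] with t ht
    have h1 : HasDerivAt (fun t : ℝ => x + t • (y - x)) (y - x) t := by
      simpa using ((hasDerivAt_id t).smul_const (y - x)).const_add x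
    have h2 : HasDerivAt h (fderiv ℝ f (x + t • (y - x)) (y - x)) t :=
      ht.hasFDerivAt.comp_hasDerivAt t h1
    rw [h2.deriv, ← mul_pow, ← sq_abs]
    refine pow_le_pow_left₀ (abs_nonneg _) ?_ 2
    rw [← inner_gradient_left, norm_sub_rev x y, mul_comm]
    exact abs_real_inner_le_norm _ _
  have h01 : (f x - f y) ^ 2 ≤
      ‖x - y‖ ^ 2 * ∫ t in Ioc (0:ℝ) 1, ‖gradient f (x + t • (y - x))‖ ^ 2 := by
    have e1 : f y - f x = ∫ t in (0:ℝ)..1, deriv h t := by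
      rw [hftc]; simp [hh]
    rw [← integral_const_mul]
    refine le_trans ?_ key
    rw [← neg_sub, neg_sq, e1, ← intervalIntegral.integral_of_le zero_le_one]
    refine sq_integral_Icc_le ?_ ?_ <;> rwa [intervalIntegrable_iff_integrableOn_Ioc_of_le zero_le_one]
  rw [← ofReal_integral_eq_lintegral_ofReal hI3 (ae_of_all _ fun t => by positivity),
    ← ENNReal.ofReal_mul (by positivity)]
  exact ENNReal.ofReal_le_ofReal h01

variable {μ : Measure E} [μ.IsAddHaarMeasure]

/-- Change of variables `y ↦ x + t • (y - x)` on a convex set, for `1 / 2 ≤ t ≤ 1`. -/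
theorem Convex.lintegral_comp_lineMap_le {C : Set E} (hC : Convex ℝ C) (hCm : MeasurableSet C)
    {G : E → ℝ≥0∞} (hG : Measurable G) {x : E} (hx : x ∈ C) {t : ℝ} (ht : 1 / 2 ≤ t) (ht1 : t ≤ 1) :
    ∫⁻ y in C, G (x + t • (y - x)) ∂μ ≤ 2 ^ Module.finrank ℝ E * ∫⁻ z in C, G z ∂μ := by
  have ht0 : 0 < t := by linarith
  have hGm : Measurable (C.indicator G) := hG.indicator hCm
  calc ∫⁻ y in C, G (x + t • (y - x)) ∂μ
      ≤ ∫⁻ y, C.indicator G ((x - t • x) + t • y) ∂μ := by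
        rw [← lintegral_indicator hCm]
        refine lintegral_mono fun y => ?_
        by_cases hy : y ∈ C
        · have : x - t • x + t • y = x + t • (y - x) := by rw [smul_sub]; abel
          have hm : x + t • (y - x) ∈ C := hC.add_smul_sub_mem hx hy ⟨ht0.le, ht1⟩
          simp [hy, this, hm]
        · simp [hy]
    _ = ENNReal.ofReal |(t ^ Module.finrank ℝ E)⁻¹| * ∫⁻ z in C, G z ∂μ := by
        have h1 := lintegral_map (μ := μ) (f := fun z => C.indicator G ((x - t • x) + z))
          (g := fun y => t • y) (by fun_prop) (by fun_prop)
        rw [← h1, Measure.map_addHaar_smul μ ht0.ne', lintegral_smul_measure,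
          lintegral_add_left_eq_self, lintegral_indicator hCm, smul_eq_mul]
    _ ≤ _ := by
        gcongr
        rw [abs_of_nonneg (by positivity), ← inv_pow, ENNReal.ofReal_pow (by positivity)]
        gcongr
        rw [← ENNReal.ofReal_ofNat]
        refine ENNReal.ofReal_le_ofReal ?_
        rw [inv_le_comm₀ ht0 (by norm_num)]; linarith

theorem Convex.lintegral_lintegral_comp_lineMap_le {C : Set E} (hC : Convex ℝ C)
    (hCm : MeasurableSet C) {G : E → ℝ≥0∞} (hG : Measurable G) {t : ℝ} (ht : 0 ≤ t) (ht1 : t ≤ 1) :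
    ∫⁻ x in C, ∫⁻ y in C, G (x + t • (y - x)) ∂μ ∂μ ≤
      2 ^ Module.finrank ℝ E * μ C * ∫⁻ z in C, G z ∂μ := by
  have aux : ∀ s : ℝ, 1 / 2 ≤ s → s ≤ 1 → ∫⁻ x in C, ∫⁻ y in C, G (x + s • (y - x)) ∂μ ∂μ ≤
      2 ^ Module.finrank ℝ E * μ C * ∫⁻ z in C, G z ∂μ := fun s hs hs1 => by
    calc _ ≤ ∫⁻ x in C, 2 ^ Module.finrank ℝ E * ∫⁻ z in C, G z ∂μ ∂μ :=
          setLIntegral_mono measurable_const fun x hx =>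
            hC.lintegral_comp_lineMap_le hCm hG hx hs hs1
      _ = _ := by rw [setLIntegral_const]; ring
  rcases le_total (1 / 2) t with h | h
  · exact aux t h ht1
  · rw [lintegral_lintegral_swap]
    · refine le_trans (le_of_eq ?_) (aux (1 - t) (by linarith) (by linarith))
      refine lintegral_congr fun y => lintegral_congr fun x => ?_
      congr 1
      module
    · exact (hG.comp (by fun_prop)).aemeasurable

/-- A Poincaré inequality in difference form on a convex set. -/
theorem Convex.lintegral_sq_sub_le {C : Set E} (hC : Convex ℝ C) (hCm : MeasurableSet C)
    {D : ℝ} (hD : ∀ x ∈ C, ∀ y ∈ C, ‖x - y‖ ≤ D) {K : NNReal} {f : E → ℝ}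
    (hf : LipschitzWith K f) :
    ∫⁻ x in C, ∫⁻ y in C, ENNReal.ofReal ((f x - f y) ^ 2) ∂μ ∂μ ≤
      ENNReal.ofReal (D ^ 2) * 2 ^ Module.finrank ℝ E * μ C *
        ∫⁻ z in C, ENNReal.ofReal (‖gradient f z‖ ^ 2) ∂μ := by
  set G : E → ℝ≥0∞ := fun z => ENNReal.ofReal (‖gradient f z‖ ^ 2) with hG
  have hGm : Measurable G := ((measurable_gradient f).norm.pow_const 2).ennreal_ofReal
  have hdiff : ∀ x, ∀ᵐ y ∂μ, ∀ᵐ t ∂(volume.restrict (Ioc (0:ℝ) 1)),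
      DifferentiableAt ℝ f (x + t • (y - x)) := fun x => by
    have hms : MeasurableSet {z | DifferentiableAt ℝ f z} := measurableSet_of_differentiableAt ℝ f
    have hmp : MeasurableSet {p : E × ℝ | DifferentiableAt ℝ f (x + p.2 • (p.1 - x))} :=
      (show Measurable fun p : E × ℝ => x + p.2 • (p.1 - x) by fun_prop) hms
    refine Measure.ae_ae_of_ae_prod (μ := μ) (ν := volume.restrict (Ioc (0:ℝ) 1))
      (p := fun p : E × ℝ => DifferentiableAt ℝ f (x + p.2 • (p.1 - x))) ?_
    have := (Measure.ae_prod_iff_ae_ae (μ := volume.restrict (Ioc (0:ℝ) 1)) (ν := μ)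
      (p := fun p : ℝ × E => DifferentiableAt ℝ f (x + p.1 • (p.2 - x)))
      ((show Measurable fun p : ℝ × E => x + p.1 • (p.2 - x) by fun_prop) hms)).2 ?_
    · rw [← Measure.prod_swap]
      rw [ae_map_iff (by fun_prop) hmp]
      exact this
    · filter_upwards [ae_restrict_mem measurableSet_Ioc] with t ht
      have hq : Measure.QuasiMeasurePreserving (fun y : E => x + t • (y - x)) μ μ := by
        have h1 : Measure.QuasiMeasurePreserving (fun y : E => t • y) μ μ := by
          refine ⟨by fun_prop, ?_⟩
          rw [Measure.map_addHaar_smul μ ht.1.ne']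
          exact Measure.smul_absolutelyContinuous
        have h2 := (measurePreserving_add_left μ (x - t • x)).quasiMeasurePreserving.comp h1
        convert h2 using 2 with y
        simp only [Function.comp]
        module
      exact hq.ae hf.ae_differentiableAt
  calc ∫⁻ x in C, ∫⁻ y in C, ENNReal.ofReal ((f x - f y) ^ 2) ∂μ ∂μ
      ≤ ∫⁻ x in C, ∫⁻ y in C, ENNReal.ofReal (D ^ 2) *
          (∫⁻ t in Ioc (0:ℝ) 1, G (x + t • (y - x))) ∂μ ∂μ := by
        refine setLIntegral_mono' hCm fun x hx => ?_
        refine lintegral_mono_ae ?_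
        filter_upwards [ae_restrict_of_ae (hdiff x), ae_restrict_mem hCm] with y hy hyC
        refine (hf.sq_sub_le_lintegral_segment x y hy).trans ?_
        gcongr
        exact hD x hx y hyC
    _ = ENNReal.ofReal (D ^ 2) * ∫⁻ t in Ioc (0:ℝ) 1, (∫⁻ x in C, ∫⁻ y in C,
          G (x + t • (y - x)) ∂μ ∂μ) := by
        have m2' : ∀ x : E, Measurable fun p : E × ℝ => G (x + p.2 • (p.1 - x)) := fun x =>
          hGm.comp (by fun_prop)
        have m4 : Measurable fun p : (E × ℝ) × E => G (p.1.1 + p.1.2 • (p.2 - p.1.1)) :=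
          hGm.comp (by fun_prop)
        have m5 : Measurable fun p : E × ℝ => ∫⁻ y in C, G (p.1 + p.2 • (y - p.1)) ∂μ :=
          m4.lintegral_prod_right'
        simp_rw [lintegral_const_mul' _ _ ENNReal.ofReal_ne_top]
        congr 1
        exact (lintegral_congr fun x => lintegral_lintegral_swap (m2' x).aemeasurable).trans
          (lintegral_lintegral_swap m5.aemeasurable)
    _ ≤ ENNReal.ofReal (D ^ 2) * ∫⁻ t in Ioc (0:ℝ) 1, (2 ^ Module.finrank ℝ E * μ C *
          ∫⁻ z in C, G z ∂μ) := by
        gcongr ENNReal.ofReal (D ^ 2) * ?_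
        exact setLIntegral_mono measurable_const fun t ht =>
          hC.lintegral_lintegral_comp_lineMap_le hCm hGm ht.1.le ht.2
    _ = _ := by
        rw [setLIntegral_const]; simp; ring

end Poincare

section Energy

variable {E : Type*} [NormedAddCommGroup E] [InnerProductSpace ℝ E] [FiniteDimensional ℝ E]

section Gradient

variable {f g : E → ℝ} {x : E}

theorem gradient_fun_sub' (hf : DifferentiableAt ℝ f x) (hg : DifferentiableAt ℝ g x) :
    gradient (fun y => f y - g y) x = gradient f x - gradient g x := by
  simp [gradient, fderiv_fun_sub hf hg]

theorem gradient_fun_const_mul' (hf : DifferentiableAt ℝ f x) (c : ℝ) :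
    gradient (fun y => c * f y) x = c • gradient f x := by
  simp [gradient, fderiv_const_mul hf]

end Gradient

theorem hasCompactSupport_of_eq_zero {Ω : Set E} (hΩ : Bornology.IsBounded Ω)
    {f : E → ℝ} (hs : ∀ x ∉ Ω, f x = 0) : HasCompactSupport f :=
  HasCompactSupport.intro (isCompact_of_isClosed_isBounded isClosed_closure hΩ.closure)
    fun x hx => hs x fun h => hx (subset_closure h)

theorem gradient_eq_zero_of_notMem_closure {Ω : Set E} {f : E → ℝ} (hs : ∀ x ∉ Ω, f x = 0)
    {x : E} (hx : x ∉ closure Ω) : gradient f x = 0 := by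
  have : f =ᶠ[nhds x] fun _ => 0 := by
    filter_upwards [isClosed_closure.isOpen_compl.mem_nhds hx] with y hy
    exact hs y fun h => hy (subset_closure h)
  simp [gradient, this.fderiv_eq]

variable [MeasurableSpace E] [BorelSpace E] {μ : Measure E} [μ.IsAddHaarMeasure]

theorem LipschitzWith.memLp_two {Ω : Set E} (hΩ : Bornology.IsBounded Ω) {K : NNReal}
    {f : E → ℝ} (hf : LipschitzWith K f) (hs : ∀ x ∉ Ω, f x = 0) : MemLp f 2 μ :=
  hf.continuous.memLp_of_hasCompactSupport (hasCompactSupport_of_eq_zero hΩ hs)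

theorem LipschitzWith.integrable_sq {Ω : Set E} (hΩ : Bornology.IsBounded Ω) {K : NNReal}
    {f : E → ℝ} (hf : LipschitzWith K f) (hs : ∀ x ∉ Ω, f x = 0) :
    Integrable (fun x => f x ^ 2) μ :=
  (hf.memLp_two hΩ hs).integrable_sq

theorem LipschitzWith.integrable_norm_gradient_sq {Ω : Set E} (hΩ : Bornology.IsBounded Ω)
    {K : NNReal} {f : E → ℝ} (hf : LipschitzWith K f) (hs : ∀ x ∉ Ω, f x = 0) :
    Integrable (fun x => ‖gradient f x‖ ^ 2) μ := by
  have hm : Measurable fun x => ‖gradient f x‖ ^ 2 := (measurable_gradient f).norm.pow_const 2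
  have h1 : IntegrableOn (fun x => ‖gradient f x‖ ^ 2) (closure Ω) μ := by
    refine Measure.integrableOn_of_bounded (M := (K:ℝ) ^ 2) hΩ.closure.measure_lt_top.ne
      hm.aestronglyMeasurable (ae_of_all _ fun x => ?_)
    rw [norm_pow, norm_norm]
    exact pow_le_pow_left₀ (norm_nonneg _) (hf.norm_gradient_le _) 2
  refine (integrableOn_iff_integrable_of_support_subset fun x hx => ?_).1 h1
  by_contra h
  exact hx (by simp [gradient_eq_zero_of_notMem_closure hs h])

theorem Continuous.integrableOn_of_isBounded {f : E → ℝ} (hf : Continuous f) {C : Set E}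
    (hC : Bornology.IsBounded C) : IntegrableOn f C μ :=
  (hf.continuousOn.integrableOn_compact
    (isCompact_of_isClosed_isBounded isClosed_closure hC.closure)).mono_set subset_closure

theorem lintegral_lintegral_sq_sub {C : Set E} (hC : Bornology.IsBounded C) {f : E → ℝ}
    (hf : Continuous f) :
    ∫⁻ x in C, ∫⁻ y in C, ENNReal.ofReal ((f x - f y) ^ 2) ∂μ ∂μ =
      ENNReal.ofReal (2 * (μ.real C * ∫ x in C, f x ^ 2 ∂μ) - 2 * (∫ x in C, f x ∂μ) ^ 2) := by
  have : IsFiniteMeasure (μ.restrict C) := ⟨by simpa using hC.measure_lt_top⟩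
  have i1 : Integrable f (μ.restrict C) := hf.integrableOn_of_isBounded hC
  have i2 : Integrable (fun x => f x ^ 2) (μ.restrict C) :=
    (hf.pow 2).integrableOn_of_isBounded hC
  have inner : ∀ x, ∫ y in C, (f x - f y) ^ 2 ∂μ =
      μ.real C * f x ^ 2 - 2 * (∫ y in C, f y ∂μ) * f x + ∫ y in C, f y ^ 2 ∂μ := fun x => by
    have : ∀ y, (f x - f y) ^ 2 = f x ^ 2 - 2 * f x * f y + f y ^ 2 := fun y => by ring
    simp_rw [this]
    have hsub : Integrable (fun y => f x ^ 2 - 2 * f x * f y) (μ.restrict C) :=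
      (integrable_const _).sub (i1.const_mul _)
    rw [integral_add hsub i2, integral_sub (integrable_const _) (i1.const_mul _),
      integral_const_mul, setIntegral_const]
    simp only [smul_eq_mul]; ring
  have hi : ∀ x, Integrable (fun y => (f x - f y) ^ 2) (μ.restrict C) := fun x =>
    (((continuous_const.sub hf).pow 2).integrableOn_of_isBounded hC)
  calc _ = ∫⁻ x in C, ENNReal.ofReal (∫ y in C, (f x - f y) ^ 2 ∂μ) ∂μ :=
        lintegral_congr fun x => (ofReal_integral_eq_lintegral_ofReal (hi x)
          (ae_of_all _ fun y => sq_nonneg _)).symm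
    _ = ENNReal.ofReal (∫ x in C, ∫ y in C, (f x - f y) ^ 2 ∂μ ∂μ) := by
        refine (ofReal_integral_eq_lintegral_ofReal ?_
          (ae_of_all _ fun x => integral_nonneg fun y => sq_nonneg _)).symm
        simp_rw [inner]
        exact ((i2.const_mul _).sub (i1.const_mul _)).add (integrable_const _)
    _ = _ := by
        simp_rw [inner]
        have hsub : Integrable (fun x => μ.real C * f x ^ 2 - 2 * (∫ y in C, f y ∂μ) * f x)
            (μ.restrict C) := (i2.const_mul _).sub (i1.const_mul _)
        rw [integral_add hsub (integrable_const _), integral_sub (i2.const_mul _)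
          (i1.const_mul _), integral_const_mul, integral_const_mul, setIntegral_const]
        congr 1
        simp only [smul_eq_mul]; ring

theorem LipschitzWith.integrableOn_norm_gradient_sq {K : NNReal} {f : E → ℝ}
    (hf : LipschitzWith K f) {C : Set E} (hC : Bornology.IsBounded C) :
    IntegrableOn (fun x => ‖gradient f x‖ ^ 2) C μ := by
  refine Measure.integrableOn_of_bounded (M := (K:ℝ) ^ 2) hC.measure_lt_top.ne
    ((measurable_gradient f).norm.pow_const 2).aestronglyMeasurable (ae_of_all _ fun x => ?_)
  rw [norm_pow, norm_norm]
  exact pow_le_pow_left₀ (norm_nonneg _) (hf.norm_gradient_le _) 2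

/-- The Poincaré inequality on a bounded convex set. -/
theorem Convex.setIntegral_sq_le {C : Set E} (hC : Convex ℝ C) (hCm : MeasurableSet C)
    (hCb : Bornology.IsBounded C) {D : ℝ} (hD : ∀ x ∈ C, ∀ y ∈ C, ‖x - y‖ ≤ D) {K : NNReal}
    {f : E → ℝ} (hf : LipschitzWith K f) :
    ∫ x in C, f x ^ 2 ∂μ ≤ D ^ 2 * 2 ^ Module.finrank ℝ E * ∫ x in C, ‖gradient f x‖ ^ 2 ∂μ +
      (μ.real C)⁻¹ * (∫ x in C, f x ∂μ) ^ 2 := by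
  have hI : 0 ≤ ∫ x in C, ‖gradient f x‖ ^ 2 ∂μ := integral_nonneg fun x => by positivity
  rcases (measureReal_nonneg (μ := μ) (s := C)).eq_or_lt with h0 | h0
  · have : μ.restrict C = 0 := by
      rw [Measure.restrict_eq_zero]
      rwa [eq_comm, measureReal_eq_zero_iff hCb.measure_lt_top.ne] at h0
    simp [this]
  have h1 := hC.lintegral_sq_sub_le (μ := μ) hCm hD hf
  rw [lintegral_lintegral_sq_sub hCb hf.continuous,
    ← ofReal_integral_eq_lintegral_ofReal (hf.integrableOn_norm_gradient_sq hCb)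
      (ae_of_all _ fun x => by positivity), ← ofReal_measureReal hCb.measure_lt_top.ne,
    ← ENNReal.ofReal_ofNat, ← ENNReal.ofReal_pow (by norm_num), ← ENNReal.ofReal_mul (by positivity),
    ← ENNReal.ofReal_mul (by positivity), ← ENNReal.ofReal_mul (by positivity),
    ENNReal.ofReal_le_ofReal_iff (by positivity)] at h1
  have h2 : ∫ x in C, f x ^ 2 ∂μ = (μ.real C)⁻¹ * (μ.real C * ∫ x in C, f x ^ 2 ∂μ) := by
    field_simp
  have h3 : D ^ 2 * 2 ^ Module.finrank ℝ E * ∫ x in C, ‖gradient f x‖ ^ 2 ∂μ =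
      (μ.real C)⁻¹ * (D ^ 2 * 2 ^ Module.finrank ℝ E * μ.real C *
        ∫ x in C, ‖gradient f x‖ ^ 2 ∂μ) := by
    field_simp
  have h4 : 0 ≤ D ^ 2 * 2 ^ Module.finrank ℝ E * μ.real C *
        ∫ x in C, ‖gradient f x‖ ^ 2 ∂μ := by positivity
  rw [h2, h3, ← mul_add]
  refine mul_le_mul_of_nonneg_left ?_ (by positivity)
  linarith

end Energy

section Grid

variable {d : ℕ}

/-- The half-open cube of side `h` with integer index `k`. -/
def gridCell (h : ℝ) (k : Fin d → ℤ) : Set (EuclideanSpace ℝ (Fin d)) :=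
  {x | ∀ i, ⌊x i / h⌋ = k i}

variable {h : ℝ}

theorem mem_gridCell_iff (hh : 0 < h) {k : Fin d → ℤ} {x : EuclideanSpace ℝ (Fin d)} :
    x ∈ gridCell h k ↔ ∀ i, x i ∈ Ico (k i * h) ((k i + 1) * h) := by
  simp only [gridCell, mem_ofPred_eq, Int.floor_eq_iff, mem_Ico, le_div_iff₀ hh, div_lt_iff₀ hh]

theorem convex_gridCell (hh : 0 < h) (k : Fin d → ℤ) : Convex ℝ (gridCell h k) := by
  intro x hx y hy a b ha hb hab
  rw [mem_gridCell_iff hh] at *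
  intro i
  exact convex_Ico _ _ (hx i) (hy i) ha hb hab

theorem measurableSet_gridCell (k : Fin d → ℤ) : MeasurableSet (gridCell h k) := by
  have : gridCell h k = ⋂ i, (fun x : EuclideanSpace ℝ (Fin d) => ⌊x i / h⌋) ⁻¹' {k i} := by
    ext; simp [gridCell]
  rw [this]
  refine MeasurableSet.iInter fun i => ?_
  exact (Int.measurable_floor.comp (by fun_prop)) (measurableSet_singleton _)

theorem norm_sub_le_of_mem_gridCell (hh : 0 < h) (k : Fin d → ℤ) :
    ∀ x ∈ gridCell h k, ∀ y ∈ gridCell h k, ‖x - y‖ ≤ √d * h := by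
  intro x hx y hy
  rw [mem_gridCell_iff hh] at *
  rw [EuclideanSpace.norm_eq, Real.sqrt_le_left (by positivity), mul_pow, Real.sq_sqrt (by simp)]
  calc ∑ i, ‖(x - y) i‖ ^ 2 ≤ ∑ i : Fin d, h ^ 2 := by
        refine Finset.sum_le_sum fun i _ => pow_le_pow_left₀ (norm_nonneg _) ?_ 2
        have := hx i; have := hy i
        simp only [mem_Ico] at *
        rw [PiLp.sub_apply, Real.norm_eq_abs, abs_le]
        constructor <;> linarith
    _ = d * h ^ 2 := by simp

theorem isBounded_gridCell (hh : 0 < h) (k : Fin d → ℤ) : Bornology.IsBounded (gridCell h k) :=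
  isBounded_iff.2 ⟨√d * h, fun x hx y hy => by
    rw [dist_eq_norm]; exact norm_sub_le_of_mem_gridCell hh k x hx y hy⟩

theorem pairwise_disjoint_gridCell : Pairwise (Function.onFun Disjoint (gridCell (d := d) h)) := by
  intro k l hkl
  refine Set.disjoint_left.2 fun x hx hy => hkl (funext fun i => ?_)
  rw [← hx i, ← hy i]

theorem Bornology.IsBounded.exists_finset_gridCell {Ω : Set (EuclideanSpace ℝ (Fin d))}
    (hΩ : Bornology.IsBounded Ω) (hh : 0 < h) :
    ∃ S : Finset (Fin d → ℤ), Ω ⊆ ⋃ k ∈ S, gridCell h k := by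
  obtain ⟨R, hR⟩ := hΩ.exists_norm_le
  refine ⟨Fintype.piFinset fun _ => Finset.Icc ⌊-R / h⌋ ⌊R / h⌋, fun x hx => ?_⟩
  simp only [mem_iUnion]
  refine ⟨fun i => ⌊x i / h⌋, ?_, fun i => rfl⟩
  rw [Fintype.mem_piFinset]
  intro i
  have h1 : |x i| ≤ R := (PiLp.norm_apply_le x i).trans (hR x hx)
  rw [abs_le] at h1
  rw [Finset.mem_Icc]
  constructor <;> apply Int.floor_le_floor <;> gcongr <;> linarith

/-- Up to an arbitrarily small multiple of the Dirichlet energy, the `L²` norm on functions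
supported in a bounded set is controlled by finitely many averages. -/
theorem exists_integral_sq_le_sum_setIntegral {Ω : Set (EuclideanSpace ℝ (Fin d))}
    (hΩ : Bornology.IsBounded Ω) {ε : ℝ} (hε : 0 < ε) :
    ∃ (S : Finset (Fin d → ℤ)) (C : (Fin d → ℤ) → Set (EuclideanSpace ℝ (Fin d)))
      (c : (Fin d → ℤ) → ℝ), (∀ k, 0 ≤ c k) ∧ (∀ k, MeasurableSet (C k)) ∧
      (∀ k, volume (C k) ≠ ∞) ∧
      ∀ (K : NNReal) (f : EuclideanSpace ℝ (Fin d) → ℝ), LipschitzWith K f →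
      (∀ x ∉ Ω, f x = 0) → ∫ x, f x ^ 2 ≤ ε * (∫ x, ‖gradient f x‖ ^ 2) +
        ∑ k ∈ S, c k * (∫ x in C k, f x) ^ 2 := by
  set A : ℝ := (√d) ^ 2 * 2 ^ d + 1 with hA
  have hA0 : 0 < A := by positivity
  set h := √(ε / A) with hh'
  have hh : 0 < h := by positivity
  have hAh : (√d * h) ^ 2 * 2 ^ d ≤ ε := by
    have : h ^ 2 = ε / A := Real.sq_sqrt (by positivity)
    rw [mul_pow, this]
    calc (√d) ^ 2 * (ε / A) * 2 ^ d = ε * ((√d) ^ 2 * 2 ^ d / A) := by ring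
      _ ≤ ε * 1 := by
        gcongr
        rw [div_le_one hA0, hA]; linarith
      _ = ε := mul_one _
  obtain ⟨S, hS⟩ := hΩ.exists_finset_gridCell hh
  refine ⟨S, gridCell h, fun k => (volume.real (gridCell h k))⁻¹,
    fun k => by positivity, measurableSet_gridCell,
    fun k => (isBounded_gridCell hh k).measure_lt_top.ne, fun K f hf hs => ?_⟩
  have hi2 : Integrable fun x => f x ^ 2 := hf.integrable_sq hΩ hs
  have hig : Integrable fun x => ‖gradient f x‖ ^ 2 := hf.integrable_norm_gradient_sq hΩ hs
  have hpd : (S : Set (Fin d → ℤ)).Pairwise (Function.onFun Disjoint (gridCell h)) :=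
    fun k _ l _ hkl => pairwise_disjoint_gridCell hkl
  have e1 : ∫ x, f x ^ 2 = ∑ k ∈ S, ∫ x in gridCell h k, f x ^ 2 := by
    rw [← integral_biUnion_finset S (fun k _ => measurableSet_gridCell k) hpd
      fun k _ => hi2.integrableOn]
    refine (setIntegral_eq_integral_of_forall_compl_eq_zero fun x hx => ?_).symm
    simp [hs x fun hx' => hx (hS hx')]
  have e2 : ∑ k ∈ S, ∫ x in gridCell h k, ‖gradient f x‖ ^ 2 ≤ ∫ x, ‖gradient f x‖ ^ 2 := by
    rw [← integral_biUnion_finset S (fun k _ => measurableSet_gridCell k) hpd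
      fun k _ => hig.integrableOn]
    exact setIntegral_le_integral hig (ae_of_all _ fun x => by positivity)
  calc ∫ x, f x ^ 2 = ∑ k ∈ S, ∫ x in gridCell h k, f x ^ 2 := e1
    _ ≤ ∑ k ∈ S, (ε * (∫ x in gridCell h k, ‖gradient f x‖ ^ 2) +
        (volume.real (gridCell h k))⁻¹ * (∫ x in gridCell h k, f x) ^ 2) := by
        refine Finset.sum_le_sum fun k _ => ?_
        refine ((convex_gridCell hh k).setIntegral_sq_le (measurableSet_gridCell k)
          (isBounded_gridCell hh k) (norm_sub_le_of_mem_gridCell hh k) hf).trans ?_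
        rw [finrank_euclideanSpace_fin]
        gcongr
    _ = ε * (∑ k ∈ S, ∫ x in gridCell h k, ‖gradient f x‖ ^ 2) +
        ∑ k ∈ S, (volume.real (gridCell h k))⁻¹ * (∫ x in gridCell h k, f x) ^ 2 := by
        rw [Finset.sum_add_distrib, Finset.mul_sum]
    _ ≤ _ := by gcongr

end Grid

section Compactness

variable {d : ℕ}

theorem integral_norm_gradient_sub_sq_le {Ω : Set (EuclideanSpace ℝ (Fin d))}
    (hΩ : Bornology.IsBounded Ω) {f g : EuclideanSpace ℝ (Fin d) → ℝ} {K L : NNReal}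
    (hf : LipschitzWith K f) (hg : LipschitzWith L g) (hfs : ∀ x ∉ Ω, f x = 0)
    (hgs : ∀ x ∉ Ω, g x = 0) :
    ∫ x, ‖gradient (fun y => f y - g y) x‖ ^ 2 ≤
      2 * (∫ x, ‖gradient f x‖ ^ 2) + 2 * ∫ x, ‖gradient g x‖ ^ 2 := by
  have i1 := hf.integrable_norm_gradient_sq (μ := volume) hΩ hfs
  have i2 := hg.integrable_norm_gradient_sq (μ := volume) hΩ hgs
  rw [← integral_const_mul, ← integral_const_mul,
    ← integral_add (i1.const_mul 2) (i2.const_mul 2)]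
  refine integral_mono_of_nonneg (ae_of_all _ fun x => by positivity)
    ((i1.const_mul 2).add (i2.const_mul 2)) ?_
  filter_upwards [hf.ae_differentiableAt, hg.ae_differentiableAt] with x hx hx'
  rw [gradient_fun_sub' hx hx']
  have := norm_sub_le (gradient f x) (gradient g x)
  nlinarith [norm_nonneg (gradient f x - gradient g x), sq_nonneg (‖gradient f x‖ - ‖gradient g x‖),
    norm_nonneg (gradient f x), norm_nonneg (gradient g x)]

theorem MeasureTheory.norm_sq_Lp_two_eq_integral {α : Type*} [MeasurableSpace α] {μ : Measure α}
    {f : α → ℝ} (hf : MemLp f 2 μ) : ‖hf.toLp f‖ ^ 2 = ∫ x, f x ^ 2 ∂μ := by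
  rw [← real_inner_self_eq_norm_sq, L2.inner_def]
  refine integral_congr_ae ?_
  filter_upwards [hf.coeFn_toLp] with x hx
  simp [hx, sq]

/-- Rellich compactness: a sequence of Lipschitz functions supported in a bounded set and bounded
in `H¹` has a subsequence converging in `L²` and almost everywhere. -/
theorem exists_subseq_tendsto_Lp_ae {Ω : Set (EuclideanSpace ℝ (Fin d))}
    (hΩ : Bornology.IsBounded Ω) {u : ℕ → EuclideanSpace ℝ (Fin d) → ℝ} {K : ℕ → NNReal}
    (hu : ∀ n, LipschitzWith (K n) (u n)) (hs : ∀ n, ∀ x ∉ Ω, u n x = 0) {M : ℝ}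
    (hM : ∀ n, ∫ x, u n x ^ 2 ≤ M) (hM' : ∀ n, ∫ x, ‖gradient (u n) x‖ ^ 2 ≤ M)
    (hm : ∀ n, MemLp (u n) 2 (volume : Measure (EuclideanSpace ℝ (Fin d)))) :
    ∃ (φ : ℕ → ℕ) (v : Lp ℝ 2 (volume : Measure (EuclideanSpace ℝ (Fin d)))), StrictMono φ ∧
      Tendsto (fun n => (hm (φ n)).toLp) atTop (nhds v) ∧
      ∀ᵐ x, Tendsto (fun n => u (φ n) x) atTop (nhds (v x)) := by
  have hM0 : 0 ≤ M := (integral_nonneg fun x => sq_nonneg _).trans (hM 0)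
  set U : ℕ → Lp ℝ 2 (volume : Measure (EuclideanSpace ℝ (Fin d))) := fun n => (hm n).toLp with hU
  have hdist : ∀ n m, dist (U n) (U m) ^ 2 = ∫ x, (u n x - u m x) ^ 2 := fun n m => by
    rw [dist_eq_norm, hU, ← MemLp.toLp_sub, norm_sq_Lp_two_eq_integral]
    rfl
  have hint : ∀ n (C : Set (EuclideanSpace ℝ (Fin d))), IntegrableOn (u n) C := fun n C =>
    ((hu n).continuous.integrable_of_hasCompactSupport
      (hasCompactSupport_of_eq_zero hΩ (hs n))).integrableOn
  set F : Ultrafilter ℕ := hyperfilter ℕ with hF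
  have hlim : ∀ C : Set (EuclideanSpace ℝ (Fin d)), volume C ≠ ∞ →
      ∃ l, Tendsto (fun n => ∫ x in C, u n x) F (nhds l) := fun C hC => by
    have hbd : ∀ n, (∫ x in C, u n x) ∈ Icc (-(M + volume.real C)) (M + volume.real C) := by
      intro n
      rw [mem_Icc, ← abs_le]
      have hI := (hu n).integrable_sq (μ := volume) hΩ (hs n)
      have : IsFiniteMeasure (volume.restrict C) := ⟨by simpa using hC.lt_top⟩
      calc |∫ x in C, u n x| ≤ ∫ x in C, |u n x| := abs_integral_le_integral_abs
        _ ≤ ∫ x in C, (u n x ^ 2 + 1) := by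
            refine integral_mono (hint n C).abs (hI.integrableOn.add (integrable_const 1))
              fun x => ?_
            change |u n x| ≤ u n x ^ 2 + 1
            rw [← sq_abs]
            nlinarith [sq_nonneg (|u n x| - 1), abs_nonneg (u n x)]
        _ = (∫ x in C, u n x ^ 2) + volume.real C := by
            rw [integral_add hI.integrableOn (integrable_const 1)]; simp
        _ ≤ M + volume.real C := by
            gcongr
            exact (setIntegral_le_integral hI (ae_of_all _ fun x => sq_nonneg _)).trans (hM n)
    obtain ⟨l, -, hl⟩ := isCompact_Icc.ultrafilter_le_nhds
      (F.map fun n => ∫ x in C, u n x) (le_principal_iff.2 (Filter.mem_map.2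
        (Filter.univ_mem' hbd)))
    exact ⟨l, hl⟩
  have hcauchy : Cauchy (Filter.map U F) := by
    rw [Metric.cauchy_iff]
    refine ⟨inferInstance, fun ε hε => ?_⟩
    obtain ⟨S, C, c, hc, -, hCf, hmain⟩ := exists_integral_sq_le_sum_setIntegral hΩ
      (show (0:ℝ) < ε ^ 2 / (8 * (M + 1)) by positivity)
    choose! l hl using fun k => hlim (C k) (hCf k)
    set η := ε ^ 2 / (4 * (∑ k ∈ S, c k + 1)) with hη
    have hS0 : 0 ≤ ∑ k ∈ S, c k := Finset.sum_nonneg fun k _ => hc k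
    have hη0 : 0 < η := by positivity
    have hev : ∀ᶠ n in (F : Filter ℕ), ∀ k ∈ S, |(∫ x in C k, u n x) - l k| < √η / 2 := by
      rw [Filter.eventually_all_finset]
      intro k _
      have := Metric.tendsto_nhds.1 (hl k) (√η / 2) (by positivity)
      simpa [Real.dist_eq] using this
    refine ⟨U '' {n | ∀ k ∈ S, |(∫ x in C k, u n x) - l k| < √η / 2}, image_mem_map hev, ?_⟩
    rintro _ ⟨n, hn, rfl⟩ _ ⟨m, hm', rfl⟩
    refine lt_of_pow_lt_pow_left₀ 2 hε.le ?_
    rw [hdist]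
    have h1 := hmain _ (fun x => u n x - u m x) ((hu n).sub (hu m))
      (fun x hx => by simp [hs n x hx, hs m x hx])
    have h2 : ∫ x, ‖gradient (fun y => u n y - u m y) x‖ ^ 2 ≤ 4 * M := by
      have := integral_norm_gradient_sub_sq_le hΩ (hu n) (hu m) (hs n) (hs m)
      linarith [hM' n, hM' m]
    have h3 : ∑ k ∈ S, c k * (∫ x in C k, (u n x - u m x)) ^ 2 ≤ ∑ k ∈ S, c k * η := by
      refine Finset.sum_le_sum fun k hk => mul_le_mul_of_nonneg_left ?_ (hc k)
      rw [integral_sub (hint n _) (hint m _), ← Real.sq_sqrt hη0.le, sq_le_sq,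
        abs_of_nonneg (Real.sqrt_nonneg η)]
      have a1 := abs_lt.1 (hn k hk)
      have a2 := abs_lt.1 (hm' k hk)
      rw [abs_le]
      constructor <;> linarith
    have h4 : ∑ k ∈ S, c k * η ≤ ε ^ 2 / 4 := by
      rw [← Finset.sum_mul, hη, mul_div_assoc', div_le_div_iff₀ (by positivity) (by positivity)]
      nlinarith [sq_nonneg ε]
    have h5 : ε ^ 2 / (8 * (M + 1)) * ∫ x, ‖gradient (fun y => u n y - u m y) x‖ ^ 2 ≤
        ε ^ 2 / 2 := by
      calc _ ≤ ε ^ 2 / (8 * (M + 1)) * (4 * M) := by gcongr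
        _ ≤ _ := by
          rw [div_mul_eq_mul_div, div_le_div_iff₀ (by positivity) (by positivity)]
          nlinarith [sq_nonneg ε]
    have : 0 < ε ^ 2 := by positivity
    linarith
  obtain ⟨v, hv⟩ := CompleteSpace.complete hcauchy
  have hcl : MapClusterPt v atTop U := by
    have hFv : Tendsto U F (nhds v) := hv
    exact hFv.mapClusterPt.mono (Nat.cofinite_eq_atTop ▸ hyperfilter_le_cofinite)
  obtain ⟨φ, hφ, hφv⟩ := hcl.tendsto_subseq
  have hmeas : TendstoInMeasure volume (fun n => (U (φ n) : EuclideanSpace ℝ (Fin d) → ℝ)) atTop v :=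
    tendstoInMeasure_of_tendsto_Lp hφv
  obtain ⟨ψ, hψ, hψv⟩ := hmeas.exists_seq_tendsto_ae
  refine ⟨φ ∘ ψ, v, hφ.comp hψ, hφv.comp hψ.tendsto_atTop, ?_⟩
  filter_upwards [hψv, ae_all_iff.2 fun n => (hm n).coeFn_toLp] with x hx hx'
  refine hx.congr fun n => ?_
  exact hx' _

end Compactness

section LogEstimate

variable {E : Type*} [NormedAddCommGroup E] [InnerProductSpace ℝ E]

theorem LipschitzWith.log_add_const {α : Type*} [PseudoMetricSpace α] {K : NNReal} {w : α → ℝ}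
    (hw : LipschitzWith K w) (hw0 : ∀ x, 0 ≤ w x) {δ : ℝ} (hδ : 0 < δ) :
    LipschitzWith (δ⁻¹.toNNReal * K) fun x => Real.log (w x + δ) := by
  refine LipschitzWith.of_le_add_mul _ fun x y => ?_
  have hx : 0 < w x + δ := by linarith [hw0 x]
  have hy : 0 < w y + δ := by linarith [hw0 y]
  have h1 : Real.log ((w x + δ) / (w y + δ)) ≤ (w x + δ) / (w y + δ) - 1 :=
    Real.log_le_sub_one_of_pos (div_pos hx hy)
  rw [Real.log_div hx.ne' hy.ne'] at h1
  have h2 : (w x + δ) / (w y + δ) - 1 = (w y + δ)⁻¹ * (w x - w y) := by field_simp; ring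
  have h3 : w x - w y ≤ K * dist x y := (le_abs_self _).trans (hw.dist_le_mul x y)
  have h4 : (w y + δ)⁻¹ ≤ δ⁻¹ := inv_anti₀ hδ (by linarith [hw0 y])
  have h5 : (w y + δ)⁻¹ * (w x - w y) ≤ δ⁻¹ * (K * dist x y) :=
    (mul_le_mul_of_nonneg_left h3 (inv_pos.2 hy).le).trans
      (mul_le_mul_of_nonneg_right h4 (by positivity))
  simp only [NNReal.coe_mul, Real.coe_toNNReal _ (inv_pos.2 hδ).le]
  linarith

theorem LipschitzWith.sq_mul_inv_add_const {α : Type*} [PseudoMetricSpace α] {K L : NNReal}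
    {w φ : α → ℝ} (hw : LipschitzWith K w) (hw0 : ∀ x, 0 ≤ w x) (hφ : LipschitzWith L φ)
    (hφ0 : ∀ x, 0 ≤ φ x) (hφ1 : ∀ x, φ x ≤ 1) {δ : ℝ} (hδ : 0 < δ) :
    ∃ M, LipschitzWith M fun x => φ x ^ 2 * (w x + δ)⁻¹ := by
  refine ⟨(2 * δ⁻¹ * L + δ⁻¹ ^ 2 * K).toNNReal, LipschitzWith.of_dist_le_mul fun x y => ?_⟩
  have hC : 0 ≤ 2 * δ⁻¹ * L + δ⁻¹ ^ 2 * K := by positivity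
  rw [Real.coe_toNNReal _ hC, Real.dist_eq]
  have hx : 0 < w x + δ := by linarith [hw0 x]
  have hy : 0 < w y + δ := by linarith [hw0 y]
  have hx' : (w x + δ)⁻¹ ≤ δ⁻¹ := inv_anti₀ hδ (by linarith [hw0 x])
  have hy' : (w y + δ)⁻¹ ≤ δ⁻¹ := inv_anti₀ hδ (by linarith [hw0 y])
  have e : φ x ^ 2 * (w x + δ)⁻¹ - φ y ^ 2 * (w y + δ)⁻¹ =
      (φ x + φ y) * (w x + δ)⁻¹ * (φ x - φ y) +
      φ y ^ 2 * ((w x + δ)⁻¹ * (w y + δ)⁻¹) * (w y - w x) := by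
    field_simp; ring
  have h1 : |φ x - φ y| ≤ L * dist x y := hφ.dist_le_mul x y
  have h2 : |w y - w x| ≤ K * dist x y := by
    rw [abs_sub_comm]; exact hw.dist_le_mul x y
  rw [e]
  refine (abs_add_le _ _).trans ?_
  rw [abs_mul (φ y ^ 2 * _), add_mul (2 * δ⁻¹ * (L : ℝ))]
  refine add_le_add ?_ ?_
  · rw [abs_mul, abs_of_nonneg (mul_nonneg (add_nonneg (hφ0 x) (hφ0 y)) (inv_pos.2 hx).le),
      mul_assoc (2 * δ⁻¹)]
    refine mul_le_mul (mul_le_mul ?_ hx' (by positivity) (by norm_num)) h1 (abs_nonneg _)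
      (by positivity)
    linarith [hφ1 x, hφ1 y]
  · rw [abs_of_nonneg (a := φ y ^ 2 * _) (by positivity), mul_assoc (δ⁻¹ ^ 2)]
    refine mul_le_mul ?_ h2 (abs_nonneg _) (by positivity)
    calc φ y ^ 2 * ((w x + δ)⁻¹ * (w y + δ)⁻¹) ≤ 1 * (δ⁻¹ * δ⁻¹) := by
          gcongr
          exact pow_le_one₀ (hφ0 y) (hφ1 y)
      _ = δ⁻¹ ^ 2 := by ring

theorem norm_sq_add_smul_le (a b : E) {p q e s : ℝ} (hp : 0 ≤ p) (hp1 : p ≤ 1) (hq : 0 ≤ q)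
    (hqe : q ≤ e) (hs : 0 ≤ s) :
    ‖a + s • ((2 * p * q) • b - (p ^ 2 * q ^ 2) • a)‖ ^ 2 ≤
      ‖a‖ ^ 2 - s * (p ^ 2 * q ^ 2 * ‖a‖ ^ 2) + 4 * s * ‖b‖ ^ 2 +
        s ^ 2 * (8 * e ^ 2 * ‖b‖ ^ 2 + 2 * e ^ 4 * ‖a‖ ^ 2) := by
  set v := (2 * p * q) • b - (p ^ 2 * q ^ 2) • a with hv
  have hpq : 0 ≤ p * q := mul_nonneg hp hq
  have hpqe : p * q ≤ e := (mul_le_of_le_one_left hq hp1).trans hqe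
  have h1 : 2 * inner ℝ a v ≤ - (p ^ 2 * q ^ 2 * ‖a‖ ^ 2) + 4 * ‖b‖ ^ 2 := by
    rw [hv, inner_sub_right, real_inner_smul_right, real_inner_smul_right,
      real_inner_self_eq_norm_sq]
    have := mul_le_mul_of_nonneg_left (real_inner_le_norm a b) hpq
    nlinarith [sq_nonneg (p * q * ‖a‖ - 2 * ‖b‖)]
  have h2 : ‖v‖ ^ 2 ≤ 8 * e ^ 2 * ‖b‖ ^ 2 + 2 * e ^ 4 * ‖a‖ ^ 2 := by
    have n1 : ‖v‖ ≤ 2 * (p * q) * ‖b‖ + (p * q) ^ 2 * ‖a‖ := by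
      refine (norm_sub_le _ _).trans (le_of_eq ?_)
      rw [norm_smul, norm_smul, Real.norm_of_nonneg (by positivity),
        Real.norm_of_nonneg (by positivity)]
      ring
    have n2 : ‖v‖ ≤ 2 * e * ‖b‖ + e ^ 2 * ‖a‖ := n1.trans (by gcongr)
    calc ‖v‖ ^ 2 ≤ (2 * e * ‖b‖ + e ^ 2 * ‖a‖) ^ 2 := by gcongr
      _ ≤ _ := by nlinarith [sq_nonneg (2 * e * ‖b‖ - e ^ 2 * ‖a‖)]
  rw [norm_add_sq_real, real_inner_smul_right, norm_smul, mul_pow, Real.norm_eq_abs, sq_abs]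
  have h3 := mul_le_mul_of_nonneg_left h1 hs
  have h4 := mul_le_mul_of_nonneg_left h2 (sq_nonneg s)
  linarith

variable [FiniteDimensional ℝ E]

theorem gradient_log_add_const {w : E → ℝ} {δ : ℝ} {x : E} (hw : DifferentiableAt ℝ w x)
    (h : w x + δ ≠ 0) :
    gradient (fun y => Real.log (w y + δ)) x = (w x + δ)⁻¹ • gradient w x := by
  have := ((Real.hasDerivAt_log h).comp_hasFDerivAt x (hw.hasFDerivAt.add_const δ)).fderiv
  simp only [gradient]
  rw [show (fun y => Real.log (w y + δ)) = Real.log ∘ fun y => w y + δ from rfl, this, map_smul]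

theorem gradient_add_mul_sq_mul_inv {w φ : E → ℝ} {δ : ℝ} {x : E} (hw : DifferentiableAt ℝ w x)
    (hφ : DifferentiableAt ℝ φ x) (h : w x + δ ≠ 0) (s : ℝ) :
    gradient (fun y => w y + s * (φ y ^ 2 * (w y + δ)⁻¹)) x = gradient w x +
      s • ((2 * φ x * (w x + δ)⁻¹) • gradient φ x -
        (φ x ^ 2 * (w x + δ)⁻¹ ^ 2) • gradient w x) := by
  have h1 : HasFDerivAt (fun y => (w y + δ)⁻¹) (-((w x + δ) ^ 2)⁻¹ • fderiv ℝ w x) x :=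
    (hasDerivAt_inv h).comp_hasFDerivAt x (hw.hasFDerivAt.add_const δ)
  have h2 := hw.hasFDerivAt.fun_add (((hφ.hasFDerivAt.pow 2).fun_mul h1).const_mul s)
  simp only [gradient]
  rw [h2.fderiv]
  simp only [map_add, map_smul, nsmul_eq_mul]
  simp only [smul_add, smul_smul, inv_pow]
  module

variable [MeasurableSpace E] [BorelSpace E] {μ : Measure E} [μ.IsAddHaarMeasure]

/-- Caccioppoli-type bound for the logarithm of an almost minimizer of the Rayleigh quotient. -/
theorem integral_sq_mul_norm_gradient_sq_le {Ω : Set E} (hΩ : Bornology.IsBounded Ω) {l : ℝ}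
    (hl0 : 0 ≤ l)
    (hl : ∀ (K : NNReal) (f : E → ℝ), LipschitzWith K f → (∀ x ∉ Ω, f x = 0) →
      l * ∫ x, f x ^ 2 ∂μ ≤ ∫ x, ‖gradient f x‖ ^ 2 ∂μ)
    {K L : NNReal} {w φ : E → ℝ} (hw : LipschitzWith K w) (hw0 : ∀ x, 0 ≤ w x)
    (hws : ∀ x ∉ Ω, w x = 0) (hφ : LipschitzWith L φ) (hφs : ∀ x ∉ Ω, φ x = 0)
    (hφ0 : ∀ x, 0 ≤ φ x) (hφ1 : ∀ x, φ x ≤ 1) {δ s : ℝ} (hδ : 0 < δ) (hs : 0 < s) :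
    Integrable (fun x => φ x ^ 2 * (w x + δ)⁻¹ ^ 2 * ‖gradient w x‖ ^ 2) μ ∧
    ∫ x, φ x ^ 2 * (w x + δ)⁻¹ ^ 2 * ‖gradient w x‖ ^ 2 ∂μ ≤
      ((∫ x, ‖gradient w x‖ ^ 2 ∂μ) - l * ∫ x, w x ^ 2 ∂μ) / s +
      4 * (∫ x, ‖gradient φ x‖ ^ 2 ∂μ) +
      s * (8 * δ⁻¹ ^ 2 * (∫ x, ‖gradient φ x‖ ^ 2 ∂μ) +
        2 * δ⁻¹ ^ 4 * ∫ x, ‖gradient w x‖ ^ 2 ∂μ) := by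
  obtain ⟨M, hM⟩ := hw.sq_mul_inv_add_const hw0 hφ hφ0 hφ1 hδ
  have hpos : ∀ x, 0 < w x + δ := fun x => by linarith [hw0 x]
  have hq : ∀ x, (w x + δ)⁻¹ ≤ δ⁻¹ := fun x => inv_anti₀ hδ (by linarith [hw0 x])
  set F : E → ℝ := fun x => w x + s * (φ x ^ 2 * (w x + δ)⁻¹) with hF
  have hFL : LipschitzWith (K + s.toNNReal * M) F := by
    refine hw.add (LipschitzWith.of_dist_le_mul fun x y => ?_)
    rw [Real.dist_eq, ← mul_sub, abs_mul, abs_of_pos hs, NNReal.coe_mul, Real.coe_toNNReal _ hs.le,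
      mul_assoc]
    exact mul_le_mul_of_nonneg_left (hM.dist_le_mul x y) hs.le
  have hFs : ∀ x ∉ Ω, F x = 0 := fun x hx => by simp [hF, hws x hx, hφs x hx]
  have iw := hw.integrable_norm_gradient_sq (μ := μ) hΩ hws
  have iφ := hφ.integrable_norm_gradient_sq (μ := μ) hΩ hφs
  have iF := hFL.integrable_norm_gradient_sq (μ := μ) hΩ hFs
  have ilog : Integrable (fun x => φ x ^ 2 * (w x + δ)⁻¹ ^ 2 * ‖gradient w x‖ ^ 2) μ := by
    have := hw.continuous.measurable
    have := hφ.continuous.measurable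
    have := measurable_gradient w
    refine (iw.const_mul (δ⁻¹ ^ 2)).mono' (Measurable.aestronglyMeasurable (by fun_prop))
      (ae_of_all _ fun x => ?_)
    have := hpos x
    rw [Real.norm_of_nonneg (by positivity)]
    gcongr
    calc φ x ^ 2 * (w x + δ)⁻¹ ^ 2 ≤ 1 * δ⁻¹ ^ 2 := by
          gcongr
          · exact pow_le_one₀ (hφ0 x) (hφ1 x)
          · linarith [hw0 x]
      _ = _ := one_mul _
  refine ⟨ilog, ?_⟩
  have hle : ∫ x, ‖gradient F x‖ ^ 2 ∂μ ≤ ∫ x, ((‖gradient w x‖ ^ 2 -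
      s * (φ x ^ 2 * (w x + δ)⁻¹ ^ 2 * ‖gradient w x‖ ^ 2)) + 4 * s * ‖gradient φ x‖ ^ 2 +
      s ^ 2 * (8 * δ⁻¹ ^ 2 * ‖gradient φ x‖ ^ 2 + 2 * δ⁻¹ ^ 4 * ‖gradient w x‖ ^ 2)) ∂μ := by
    refine integral_mono_ae iF (((iw.sub (ilog.const_mul s)).add (iφ.const_mul _)).add
      (((iφ.const_mul _).add (iw.const_mul _)).const_mul _)) ?_
    filter_upwards [hw.ae_differentiableAt, hφ.ae_differentiableAt] with x hx hx'
    rw [hF, gradient_add_mul_sq_mul_inv hx hx' (hpos x).ne' s]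
    exact norm_sq_add_smul_le _ _ (hφ0 x) (hφ1 x) (inv_nonneg.2 (hpos x).le) (hq x) hs.le
  have j1 : Integrable (fun x => ‖gradient w x‖ ^ 2 -
      s * (φ x ^ 2 * (w x + δ)⁻¹ ^ 2 * ‖gradient w x‖ ^ 2)) μ := iw.sub (ilog.const_mul s)
  have j2 : Integrable (fun x => ‖gradient w x‖ ^ 2 -
      s * (φ x ^ 2 * (w x + δ)⁻¹ ^ 2 * ‖gradient w x‖ ^ 2) + 4 * s * ‖gradient φ x‖ ^ 2) μ :=
    j1.add (iφ.const_mul _)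
  have j3 : Integrable (fun x => 8 * δ⁻¹ ^ 2 * ‖gradient φ x‖ ^ 2 +
      2 * δ⁻¹ ^ 4 * ‖gradient w x‖ ^ 2) μ := (iφ.const_mul _).add (iw.const_mul _)
  rw [integral_add j2 (j3.const_mul _), integral_add j1 (iφ.const_mul _),
    integral_sub iw (ilog.const_mul s), integral_const_mul, integral_const_mul, integral_const_mul,
    integral_add (iφ.const_mul _) (iw.const_mul _), integral_const_mul, integral_const_mul] at hle
  have hmono : ∫ x, w x ^ 2 ∂μ ≤ ∫ x, F x ^ 2 ∂μ := by
    refine integral_mono (hw.integrable_sq hΩ hws) (hFL.integrable_sq hΩ hFs) fun x => ?_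
    refine pow_le_pow_left₀ (hw0 x) ?_ 2
    have := hpos x
    have : 0 ≤ s * (φ x ^ 2 * (w x + δ)⁻¹) := by positivity
    simp only [hF]; linarith
  have h1 := hl _ F hFL hFs
  have h2 := mul_le_mul_of_nonneg_left hmono hl0
  rw [← sub_le_iff_le_add, ← sub_le_iff_le_add, le_div_iff₀ hs]
  nlinarith

end LogEstimate

section MinimumPrinciple

theorem exists_lipschitz_cutoff {α : Type*} [PseudoMetricSpace α] (c : α) {r : ℝ} (hr : 0 < r) :
    ∃ (L : NNReal) (φ : α → ℝ), LipschitzWith L φ ∧ (∀ x, 0 ≤ φ x) ∧ (∀ x, φ x ≤ 1) ∧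
      (∀ x ∈ ball c r, φ x = 1) ∧ ∀ x ∉ ball c (2 * r), φ x = 0 := by
  refine ⟨r⁻¹.toNNReal, fun x => max (min (2 - r⁻¹ * dist x c) 1) 0, ?_, fun x => le_max_right _ _,
    fun x => max_le (min_le_right _ _) zero_le_one, fun x hx => ?_, fun x hx => ?_⟩
  · refine LipschitzWith.max_const (LipschitzWith.min_const ?_ 1) 0
    refine LipschitzWith.of_le_add_mul _ fun x y => ?_
    rw [Real.coe_toNNReal _ (inv_pos.2 hr).le]
    have h := mul_le_mul_of_nonneg_left (dist_triangle_left y c x) (inv_pos.2 hr).le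
    rw [mul_add] at h
    linarith
  · rw [mem_ball] at hx
    have : r⁻¹ * dist x c ≤ 1 := by rw [inv_mul_le_one₀ hr]; exact hx.le
    have h2 : 1 ≤ 2 - r⁻¹ * dist x c := by linarith
    show max (min (2 - r⁻¹ * dist x c) 1) 0 = 1
    rw [min_eq_right h2, max_eq_left zero_le_one]
  · rw [mem_ball, not_lt] at hx
    have : 2 ≤ r⁻¹ * dist x c := by rw [le_inv_mul_iff₀ hr]; linarith
    have h2 : 2 - r⁻¹ * dist x c ≤ 0 := by linarith
    exact max_eq_right ((min_le_left _ _).trans h2)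

variable {E : Type*} [MeasurableSpace E] {μ : Measure E}

/-- If the oscillation of `log (w + δ)` on `B` is bounded uniformly in `δ`, then `w` either
vanishes almost everywhere or is nonzero almost everywhere on `B`. -/
theorem measure_eq_zero_or_of_lintegral_log_le {B : Set E} (hB : MeasurableSet B) (hBf : μ B ≠ ∞)
    {w : E → ℝ} (hw : Measurable w) (hw0 : ∀ x, 0 ≤ w x) {A : ℝ≥0∞} (hA : A ≠ ∞)
    (h : ∀ δ : ℝ, 0 < δ → ∫⁻ x in B, ∫⁻ y in B,
      ENNReal.ofReal ((Real.log (w x + δ) - Real.log (w y + δ)) ^ 2) ∂μ ∂μ ≤ A) :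
    μ (B ∩ {x | w x ≠ 0}) = 0 ∨ μ (B ∩ {x | w x = 0}) = 0 := by
  by_contra! hcon
  obtain ⟨hP, hZ⟩ := hcon
  set Z := B ∩ {x | w x = 0} with hZdef
  have hZm : MeasurableSet Z := hB.inter (hw (measurableSet_singleton 0))
  obtain ⟨k, hk⟩ : ∃ k : ℕ, μ (B ∩ {x | 1 / ((k:ℝ) + 1) ≤ w x}) ≠ 0 := by
    by_contra! hall
    refine hP (measure_mono_null ?_ (measure_iUnion_null hall))
    rintro x ⟨hxB, hx⟩
    obtain ⟨k, hk⟩ := exists_nat_one_div_lt ((hw0 x).lt_of_ne' hx)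
    exact mem_iUnion.2 ⟨k, hxB, hk.le⟩
  set η : ℝ := 1 / ((k:ℝ) + 1) with hη
  have hη0 : 0 < η := by positivity
  set P := B ∩ {x | η ≤ w x} with hPdef
  have hPm : MeasurableSet P := hB.inter (measurableSet_le measurable_const hw)
  have hPf : μ P ≠ ∞ := measure_ne_top_of_subset inter_subset_left hBf
  have hZf : μ Z ≠ ∞ := measure_ne_top_of_subset inter_subset_left hBf
  have hP0 : 0 < (μ P).toReal := ENNReal.toReal_pos hk hPf
  have hZ0 : 0 < (μ Z).toReal := ENNReal.toReal_pos hZ hZf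
  have key : ∀ T : ℝ, 0 < T → T ^ 2 * (μ P).toReal * (μ Z).toReal ≤ A.toReal := by
    intro T hT
    have hexp : 0 < Real.exp T - 1 := by
      have := Real.add_one_lt_exp hT.ne'
      linarith
    set δ := η / (Real.exp T - 1) with hδ
    have hδ0 : 0 < δ := by positivity
    have hlog : Real.log (η + δ) = T + Real.log δ := by
      have : η + δ = Real.exp T * δ := by
        rw [hδ]; field_simp; ring
      rw [this, Real.log_mul (Real.exp_pos T).ne' hδ0.ne', Real.log_exp]
    have hle : ENNReal.ofReal (T ^ 2) * μ P * μ Z ≤ A := by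
      refine le_trans ?_ (h δ hδ0)
      calc ENNReal.ofReal (T ^ 2) * μ P * μ Z
          = ∫⁻ x in Z, ∫⁻ y in P, ENNReal.ofReal (T ^ 2) ∂μ ∂μ := by
            rw [setLIntegral_const, setLIntegral_const]
        _ ≤ ∫⁻ x in Z, ∫⁻ y in B,
              ENNReal.ofReal ((Real.log (w x + δ) - Real.log (w y + δ)) ^ 2) ∂μ ∂μ := by
            refine setLIntegral_mono' hZm fun x hx => ?_
            refine le_trans ?_ (lintegral_mono_set (inter_subset_left : P ⊆ B))
            refine setLIntegral_mono' hPm fun y hy => ENNReal.ofReal_le_ofReal ?_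
            have hx0 : w x = 0 := hx.2
            have hy0 : η ≤ w y := hy.2
            have : Real.log (η + δ) ≤ Real.log (w y + δ) :=
              Real.log_le_log (by positivity) (by linarith)
            rw [hx0, zero_add]
            nlinarith
        _ ≤ _ := lintegral_mono_set inter_subset_left
    have := ENNReal.toReal_mono hA hle
    rwa [ENNReal.toReal_mul, ENNReal.toReal_mul, ENNReal.toReal_ofReal (sq_nonneg T)] at this
  set m := (μ P).toReal * (μ Z).toReal with hm
  have hm0 : 0 < m := mul_pos hP0 hZ0
  have hA0 : 0 ≤ A.toReal := ENNReal.toReal_nonneg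
  have := key (√(A.toReal / m + 1)) (by positivity)
  rw [Real.sq_sqrt (by positivity), mul_assoc, ← hm, add_mul, div_mul_cancel₀ _ hm0.ne'] at this
  linarith

theorem IsPreconnected.measure_eq_zero_or [PseudoMetricSpace E] [SecondCountableTopology E]
    [μ.IsOpenPosMeasure] {Ω : Set E} (hΩo : IsOpen Ω) (hΩ : IsPreconnected Ω) {Z : Set E}
    (h : ∀ x r, 0 < r → ball x (2 * r) ⊆ Ω → μ (ball x r ∩ Zᶜ) = 0 ∨ μ (ball x r ∩ Z) = 0) :
    μ (Ω ∩ Zᶜ) = 0 ∨ μ (Ω ∩ Z) = 0 := by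
  set U : Set E → Set E := fun S => {x | ∃ r > 0, μ (ball x r ∩ S) = 0} with hU
  have hopen : ∀ S, IsOpen (U S) := fun S => by
    rw [Metric.isOpen_iff]
    rintro x ⟨r, hr, hx⟩
    refine ⟨r, hr, fun y hy => ⟨r - dist y x, by simpa using hy, ?_⟩⟩
    exact measure_mono_null (inter_subset_inter_left _ (ball_subset_ball' (by linarith))) hx
  have hcover : Ω ⊆ U Zᶜ ∪ U Z := fun x hx => by
    obtain ⟨r, hr, hxr⟩ := Metric.isOpen_iff.1 hΩo x hx
    rcases h x (r / 2) (by positivity) (by rwa [mul_div_cancel₀ _ two_ne_zero]) with h0 | h0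
    · exact Or.inl ⟨r / 2, by positivity, h0⟩
    · exact Or.inr ⟨r / 2, by positivity, h0⟩
  have hnull : ∀ S, Ω ⊆ U S → μ (Ω ∩ S) = 0 := fun S hS => by
    refine measure_null_of_locally_null _ fun x hx => ?_
    obtain ⟨r, hr, h0⟩ := hS hx.1
    refine ⟨ball x r ∩ S, ?_, h0⟩
    exact mem_of_superset (inter_mem_nhdsWithin _ (ball_mem_nhds x hr))
      fun y hy => ⟨hy.2, hy.1.2⟩
  by_contra! hcon
  have hne : ∀ S, μ (Ω ∩ S) ≠ 0 → ¬ Ω ⊆ U S := fun S h0 hS => h0 (hnull S hS)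
  obtain ⟨x, hxΩ, hx⟩ := not_subset.1 (hne _ hcon.1)
  obtain ⟨y, hyΩ, hy⟩ := not_subset.1 (hne _ hcon.2)
  obtain ⟨z, -, ⟨r, hr, hz⟩, ⟨s, hs, hz'⟩⟩ := hΩ _ _ (hopen _) (hopen _) hcover
    ⟨y, hyΩ, (hcover hyΩ).resolve_right hy⟩ ⟨x, hxΩ, (hcover hxΩ).resolve_left hx⟩
  have hpos : 0 < μ (ball z (min r s)) := measure_ball_pos μ z (lt_min hr hs)
  refine hpos.ne' (measure_mono_null (fun p hp => ?_) (measure_union_null hz hz'))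
  by_cases hpZ : p ∈ Z
  · exact Or.inr ⟨ball_subset_ball (min_le_right _ _) hp, hpZ⟩
  · exact Or.inl ⟨ball_subset_ball (min_le_left _ _) hp, hpZ⟩

end MinimumPrinciple

section StrongMinimum

variable {E : Type*} [NormedAddCommGroup E] [InnerProductSpace ℝ E] [FiniteDimensional ℝ E]
  [MeasurableSpace E] [BorelSpace E] {μ : Measure E} [μ.IsAddHaarMeasure]

set_option maxHeartbeats 1000000 in
/-- The limit of a nonnegative minimizing sequence for the Rayleigh quotient either vanishes
almost everywhere or is nonzero almost everywhere on a ball. -/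
theorem measure_ball_eq_zero_or_of_minimizing {Ω : Set E} (hΩ : Bornology.IsBounded Ω) {l : ℝ}
    (hl0 : 0 ≤ l)
    (hl : ∀ (K : NNReal) (f : E → ℝ), LipschitzWith K f → (∀ x ∉ Ω, f x = 0) →
      l * ∫ x, f x ^ 2 ∂μ ≤ ∫ x, ‖gradient f x‖ ^ 2 ∂μ)
    {K : ℕ → NNReal} {u : ℕ → E → ℝ} (hu : ∀ n, LipschitzWith (K n) (u n))
    (hu0 : ∀ n x, 0 ≤ u n x) (hus : ∀ n, ∀ x ∉ Ω, u n x = 0)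
    {M : ℝ} (hM : ∀ n, ∫ x, ‖gradient (u n) x‖ ^ 2 ∂μ ≤ M)
    (hQ : Tendsto (fun n => (∫ x, ‖gradient (u n) x‖ ^ 2 ∂μ) - l * ∫ x, u n x ^ 2 ∂μ)
      atTop (nhds 0))
    {w : E → ℝ} (hw : Measurable w) (hw0 : ∀ x, 0 ≤ w x)
    (hlim : ∀ᵐ x ∂μ, Tendsto (fun n => u n x) atTop (nhds (w x)))
    {c : E} {r : ℝ} (hr : 0 < r) (hc : ball c (2 * r) ⊆ Ω) :
    μ (ball c r ∩ {x | w x ≠ 0}) = 0 ∨ μ (ball c r ∩ {x | w x = 0}) = 0 := by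
  obtain ⟨L, φ, hφ, hφ0, hφ1, hφB, hφs⟩ := exists_lipschitz_cutoff c hr
  have hφs' : ∀ x ∉ Ω, φ x = 0 := fun x hx => hφs x fun h => hx (hc h)
  set B := ball c r with hB
  set e := ∫ x, ‖gradient φ x‖ ^ 2 ∂μ with he
  have he0 : 0 ≤ e := integral_nonneg fun x => by positivity
  have hM0 : 0 ≤ M := (integral_nonneg fun x => by positivity).trans (hM 0)
  have hBf : μ B ≠ ∞ := measure_ball_lt_top.ne
  set A : ℝ≥0∞ := ENNReal.ofReal ((2 * r) ^ 2) * 2 ^ Module.finrank ℝ E * μ B *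
    ENNReal.ofReal (4 * e + 2) with hA
  have hAf : A ≠ ∞ := by
    refine ENNReal.mul_ne_top (ENNReal.mul_ne_top (ENNReal.mul_ne_top ENNReal.ofReal_ne_top
      (by simp)) hBf) ENNReal.ofReal_ne_top
  refine measure_eq_zero_or_of_lintegral_log_le measurableSet_ball hBf hw hw0 hAf fun δ hδ => ?_
  set D := 8 * δ⁻¹ ^ 2 * e + 2 * δ⁻¹ ^ 4 * M with hD
  have hD0 : 0 ≤ D := by positivity
  set s := (D + 1)⁻¹ with hs
  have hs0 : 0 < s := by positivity
  have hsD : s * D ≤ 1 := by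
    rw [hs, inv_mul_le_one₀ (by positivity)]; linarith
  set F : ℕ → E → E → ℝ≥0∞ := fun n x y =>
    ENNReal.ofReal ((Real.log (u n x + δ) - Real.log (u n y + δ)) ^ 2) with hF
  have hbound : ∀ᶠ n in atTop, ∫⁻ x in B, ∫⁻ y in B, F n x y ∂μ ∂μ ≤ A := by
    filter_upwards [hQ.eventually (gt_mem_nhds hs0)] with n hn
    have hpos : ∀ x, 0 < u n x + δ := fun x => by linarith [hu0 n x]
    obtain ⟨hint, hle⟩ := integral_sq_mul_norm_gradient_sq_le hΩ hl0 hl (hu n) (hu0 n) (hus n)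
      hφ hφs' hφ0 hφ1 hδ hs0
    refine ((convex_ball c r).lintegral_sq_sub_le measurableSet_ball (D := 2 * r) ?_
      ((hu n).log_add_const (hu0 n) hδ)).trans ?_
    · intro x hx y hy
      rw [← dist_eq_norm]
      have := dist_triangle_right x y c
      rw [mem_ball] at hx hy
      linarith
    · rw [hA]
      gcongr
      calc ∫⁻ z in B, ENNReal.ofReal (‖gradient (fun x => Real.log (u n x + δ)) z‖ ^ 2) ∂μ
          = ∫⁻ z in B, ENNReal.ofReal
              (φ z ^ 2 * (u n z + δ)⁻¹ ^ 2 * ‖gradient (u n) z‖ ^ 2) ∂μ := by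
            refine lintegral_congr_ae ?_
            filter_upwards [ae_restrict_of_ae (hu n).ae_differentiableAt,
              ae_restrict_mem measurableSet_ball] with z hz hzB
            rw [gradient_log_add_const hz (hpos z).ne', norm_smul, mul_pow, Real.norm_eq_abs,
              sq_abs, hφB z hzB]
            ring_nf
        _ ≤ ∫⁻ z, ENNReal.ofReal
              (φ z ^ 2 * (u n z + δ)⁻¹ ^ 2 * ‖gradient (u n) z‖ ^ 2) ∂μ := setLIntegral_le_lintegral _ _
        _ = ENNReal.ofReal (∫ z, φ z ^ 2 * (u n z + δ)⁻¹ ^ 2 * ‖gradient (u n) z‖ ^ 2 ∂μ) :=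
            (ofReal_integral_eq_lintegral_ofReal hint (ae_of_all _ fun z => by positivity)).symm
        _ ≤ ENNReal.ofReal (4 * e + 2) := by
            refine ENNReal.ofReal_le_ofReal (hle.trans ?_)
            have h1 : ((∫ x, ‖gradient (u n) x‖ ^ 2 ∂μ) - l * ∫ x, u n x ^ 2 ∂μ) / s ≤ 1 := by
              rw [div_le_one hs0]; exact hn.le
            have h2 : s * (8 * δ⁻¹ ^ 2 * e + 2 * δ⁻¹ ^ 4 * ∫ x, ‖gradient (u n) x‖ ^ 2 ∂μ) ≤
                s * D := by
              rw [hD]; gcongr; exact hM n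
            linarith
  have hmu : ∀ n, Measurable (u n) := fun n => (hu n).continuous.measurable
  have hFm : ∀ n, Measurable fun p : E × E => F n p.1 p.2 := fun n => by
    have := hmu n
    exact ((((this.comp measurable_fst).add_const δ).log.sub
      ((this.comp measurable_snd).add_const δ).log).pow_const 2).ennreal_ofReal
  have hlog : ∀ x, Tendsto (fun n => u n x) atTop (nhds (w x)) →
      Tendsto (fun n => Real.log (u n x + δ)) atTop (nhds (Real.log (w x + δ))) := fun x hx =>
    (hx.add_const δ).log (by linarith [hw0 x])
  calc _ ≤ ∫⁻ x in B, liminf (fun n => ∫⁻ y in B, F n x y ∂μ) atTop ∂μ := by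
        refine lintegral_mono_ae ?_
        filter_upwards [ae_restrict_of_ae hlim] with x hx
        refine le_trans (le_of_eq ?_) (lintegral_liminf_le fun n =>
          (hFm n).comp measurable_prodMk_left)
        refine lintegral_congr_ae ?_
        filter_upwards [ae_restrict_of_ae hlim] with y hy
        exact ((ENNReal.continuous_ofReal.tendsto _).comp
          (((hlog x hx).sub (hlog y hy)).pow 2)).liminf_eq.symm
    _ ≤ liminf (fun n => ∫⁻ x in B, ∫⁻ y in B, F n x y ∂μ ∂μ) atTop :=
        lintegral_liminf_le fun n => (hFm n).lintegral_prod_right'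
    _ ≤ A := (liminf_le_limsup).trans (limsup_le_of_le (by isBoundedDefault) hbound)

end StrongMinimum

section PosNegParts

variable {E : Type*} [NormedAddCommGroup E] [InnerProductSpace ℝ E] [FiniteDimensional ℝ E]

theorem norm_gradient_sq_eq_posPart_add_negPart {f : E → ℝ} {x : E}
    (hp : DifferentiableAt ℝ (fun y => max (f y) 0) x)
    (hn : DifferentiableAt ℝ (fun y => max (-f y) 0) x) :
    ‖gradient f x‖ ^ 2 = ‖gradient (fun y => max (f y) 0) x‖ ^ 2 +
      ‖gradient (fun y => max (-f y) 0) x‖ ^ 2 := by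
  have hmin : ∀ h : E → ℝ, h x ≤ 0 → gradient (fun y => max (h y) 0) x = 0 := fun h hx => by
    have : IsLocalMin (fun y => max (h y) 0) x := Eventually.of_forall fun y => by
      simp only [max_eq_right hx]; exact le_max_right _ _
    simp [gradient, this.fderiv_eq_zero]
  have hf : f = fun y => max (f y) 0 - max (-f y) 0 := by
    ext y; rcases le_total (f y) 0 with h | h <;> simp [h]
  have hg : gradient f x = gradient (fun y => max (f y) 0) x -
      gradient (fun y => max (-f y) 0) x := by
    rw [← gradient_fun_sub' hp hn, ← hf]
  rw [hg]
  rcases le_total (f x) 0 with h | h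
  · simp [hmin f h]
  · simp [hmin (fun y => -f y) (by simpa using h)]

variable [MeasurableSpace E] [BorelSpace E] {μ : Measure E} [μ.IsAddHaarMeasure]

theorem energy_negPart_le {Ω : Set E} (hΩ : Bornology.IsBounded Ω) {l : ℝ}
    (hl : ∀ (K : NNReal) (f : E → ℝ), LipschitzWith K f → (∀ x ∉ Ω, f x = 0) →
      l * ∫ x, f x ^ 2 ∂μ ≤ ∫ x, ‖gradient f x‖ ^ 2 ∂μ)
    {K : NNReal} {f : E → ℝ} (hf : LipschitzWith K f) (hfs : ∀ x ∉ Ω, f x = 0) :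
    (∫ x, ‖gradient (fun y => max (-f y) 0) x‖ ^ 2 ∂μ) - l * ∫ x, max (-f x) 0 ^ 2 ∂μ ≤
      (∫ x, ‖gradient f x‖ ^ 2 ∂μ) - l * ∫ x, f x ^ 2 ∂μ ∧
    ∫ x, ‖gradient (fun y => max (-f y) 0) x‖ ^ 2 ∂μ ≤ ∫ x, ‖gradient f x‖ ^ 2 ∂μ := by
  have hp : LipschitzWith K fun x => max (f x) 0 := hf.max_const 0
  have hn : LipschitzWith K fun x => max (-f x) 0 := hf.neg.max_const 0
  have hps : ∀ x ∉ Ω, max (f x) 0 = 0 := fun x hx => by simp [hfs x hx]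
  have hns : ∀ x ∉ Ω, max (-f x) 0 = 0 := fun x hx => by simp [hfs x hx]
  have h1 : ∫ x, ‖gradient f x‖ ^ 2 ∂μ = (∫ x, ‖gradient (fun y => max (f y) 0) x‖ ^ 2 ∂μ) +
      ∫ x, ‖gradient (fun y => max (-f y) 0) x‖ ^ 2 ∂μ := by
    rw [← integral_add (hp.integrable_norm_gradient_sq hΩ hps)
      (hn.integrable_norm_gradient_sq hΩ hns)]
    refine integral_congr_ae ?_
    filter_upwards [hp.ae_differentiableAt, hn.ae_differentiableAt] with x hx hx'
    exact norm_gradient_sq_eq_posPart_add_negPart hx hx'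
  have h2 : ∫ x, f x ^ 2 ∂μ = (∫ x, max (f x) 0 ^ 2 ∂μ) + ∫ x, max (-f x) 0 ^ 2 ∂μ := by
    rw [← integral_add (hp.integrable_sq hΩ hps) (hn.integrable_sq hΩ hns)]
    refine integral_congr_ae (ae_of_all _ fun x => ?_)
    rcases le_total (f x) 0 with h | h <;> simp [h]
  have h3 := hl _ _ hp hps
  refine ⟨by rw [h1, h2]; linarith, ?_⟩
  rw [h1]
  have : 0 ≤ ∫ x, ‖gradient (fun y => max (f y) 0) x‖ ^ 2 ∂μ :=
    integral_nonneg fun x => by positivity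
  linarith

end PosNegParts

section Twisted

theorem MeasureTheory.ae_eq_zero_of_integral_mul_eq_zero {α : Type*} [MeasurableSpace α]
    {μ : Measure α} {f g : α → ℝ} (hf : 0 ≤ᵐ[μ] f) (hg : ∀ᵐ x ∂μ, f x ≠ 0 → 0 < g x)
    (hfg : Integrable (fun x => f x * g x) μ) (h : ∫ x, f x * g x ∂μ = 0) : f =ᵐ[μ] 0 := by
  have h0 : 0 ≤ᵐ[μ] fun x => f x * g x := by
    filter_upwards [hf, hg] with x hx hx'
    by_cases h0 : f x = 0
    · simp [h0]
    · exact mul_nonneg hx (hx' h0).le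
  filter_upwards [(integral_eq_zero_iff_of_nonneg_ae h0 hfg).1 h, hg] with x hx hx'
  by_contra h0
  exact mul_ne_zero h0 (hx' h0).ne' hx

variable {d : ℕ} {Ω : Set (EuclideanSpace ℝ (Fin d))} {g : EuclideanSpace ℝ (Fin d) → ℝ}

theorem memLp_indicator_of_ae_le_one (hΩo : IsOpen Ω) (hΩ : Bornology.IsBounded Ω)
    (hgm : Measurable g) (hg : ∀ᵐ x, 0 < g x ∧ g x ≤ 1) : MemLp (Ω.indicator g) 2 volume := by
  rw [memLp_indicator_iff_restrict hΩo.measurableSet]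
  have : IsFiniteMeasure (volume.restrict Ω) := ⟨by simpa using hΩ.measure_lt_top⟩
  refine MemLp.of_bound hgm.aestronglyMeasurable 1 (ae_restrict_of_ae ?_)
  filter_upwards [hg] with x hx
  rw [Real.norm_of_nonneg hx.1.le]
  exact hx.2

/-- A positive weight cannot be orthogonal to a minimizing sequence of the Dirichlet
Rayleigh quotient. -/
theorem not_minimizing_of_integral_mul_eq_zero (hΩo : IsOpen Ω) (hΩ : Bornology.IsBounded Ω)
    (hΩc : IsPreconnected Ω) (hgm : Measurable g) (hg : ∀ᵐ x, 0 < g x ∧ g x ≤ 1) {l : ℝ}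
    (hl0 : 0 ≤ l)
    (hl : ∀ (K : NNReal) (f : EuclideanSpace ℝ (Fin d) → ℝ), LipschitzWith K f →
      (∀ x ∉ Ω, f x = 0) → l * ∫ x, f x ^ 2 ≤ ∫ x, ‖gradient f x‖ ^ 2)
    {K : ℕ → NNReal} {u : ℕ → EuclideanSpace ℝ (Fin d) → ℝ} (hu : ∀ n, LipschitzWith (K n) (u n))
    (hs : ∀ n, ∀ x ∉ Ω, u n x = 0) (h1 : ∀ n, ∫ x, u n x ^ 2 = 1)
    (horth : ∀ n, ∫ x, u n x * g x = 0)
    (hE : Tendsto (fun n => ∫ x, ‖gradient (u n) x‖ ^ 2) atTop (nhds l)) : False := by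
  obtain ⟨M, hM⟩ := hE.bddAbove_range
  have hM' : ∀ n, ∫ x, ‖gradient (u n) x‖ ^ 2 ≤ M := fun n => hM (mem_range_self n)
  have hm : ∀ n, MemLp (u n) 2 (volume : Measure (EuclideanSpace ℝ (Fin d))) :=
    fun n => (hu n).memLp_two hΩ (hs n)
  obtain ⟨φ, v, hφ, hv, hae⟩ := exists_subseq_tendsto_Lp_ae hΩ hu hs (M := max 1 M)
    (fun n => (h1 n).le.trans (le_max_left _ _)) (fun n => (hM' n).trans (le_max_right _ _)) hm
  have hvm : Measurable v := (Lp.stronglyMeasurable v).measurable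
  have hvs : ∀ᵐ x, x ∉ Ω → v x = 0 := by
    filter_upwards [hae] with x hx hxΩ
    refine tendsto_nhds_unique hx ?_
    simp [hs _ x hxΩ]
  have hnorm : ‖v‖ = 1 := by
    refine tendsto_nhds_unique hv.norm ?_
    have : ∀ n, ‖(hm (φ n)).toLp‖ = 1 := fun n => by
      have := norm_sq_Lp_two_eq_integral (hm (φ n))
      rw [h1] at this
      exact (pow_eq_one_iff_of_nonneg (norm_nonneg _) two_ne_zero).1 this
    simp [this]
  have hG := memLp_indicator_of_ae_le_one hΩo hΩ hgm hg
  have hinner : ∀ (f : EuclideanSpace ℝ (Fin d) → ℝ) (w : Lp ℝ 2 volume), w =ᵐ[volume] f →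
      inner ℝ hG.toLp w = ∫ x, f x * Ω.indicator g x := fun f w hw => by
    rw [L2.inner_def]
    refine integral_congr_ae ?_
    filter_upwards [hG.coeFn_toLp, hw] with x hx hx'
    simp [hx, hx']
  have hvG : ∫ x, v x * Ω.indicator g x = 0 := by
    rw [← hinner v v (ae_eq_refl _)]
    refine tendsto_nhds_unique (tendsto_const_nhds.inner hv) ?_
    have : ∀ n, inner ℝ hG.toLp (hm (φ n)).toLp = 0 := fun n => by
      rw [hinner _ _ (hm (φ n)).coeFn_toLp, ← horth (φ n)]
      refine integral_congr_ae (ae_of_all _ fun x => ?_)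
      by_cases hx : x ∈ Ω
      · simp [hx]
      · simp [hx, hs _ x hx]
    simp [this]
  have hvGi : Integrable fun x => v x * Ω.indicator g x := (Lp.memLp v).integrable_mul hG
  have hpos : ∀ᵐ x, v x ≠ 0 → 0 < Ω.indicator g x := by
    filter_upwards [hvs, hg] with x hx hx' h0
    have : x ∈ Ω := by_contra fun h => h0 (hx h)
    rw [indicator_of_mem this]
    exact hx'.1
  have hv0 : ¬ v =ᵐ[volume] 0 := fun h => by
    rw [(Lp.eq_zero_iff_ae_eq_zero).2 h] at hnorm
    simp at hnorm
  have hQ : Tendsto (fun n => (∫ x, ‖gradient (fun y => max (-u (φ n) y) 0) x‖ ^ 2) -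
      l * ∫ x, max (-u (φ n) x) 0 ^ 2) atTop (nhds 0) := by
    have hE' := (hE.comp hφ.tendsto_atTop).sub_const l
    rw [sub_self] at hE'
    refine tendsto_of_tendsto_of_tendsto_of_le_of_le tendsto_const_nhds hE' (fun n => ?_)
      fun n => ?_
    · exact sub_nonneg.2 (hl _ _ ((hu (φ n)).neg.max_const 0) fun x hx => by simp [hs _ x hx])
    · simpa [h1] using (energy_negPart_le hΩ hl (hu (φ n)) (hs _)).1
  have hdich := hΩc.measure_eq_zero_or hΩo (μ := volume) (Z := {x | max (-v x) 0 = 0})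
    fun c r hr hc => measure_ball_eq_zero_or_of_minimizing hΩ hl0 hl
      (u := fun n x => max (-u (φ n) x) 0) (w := fun x => max (-v x) 0) (M := M)
      (fun n => (hu (φ n)).neg.max_const 0) (fun n x => le_max_right _ _)
      (fun n x hx => by simp [hs _ x hx])
      (fun n => (energy_negPart_le hΩ hl (hu (φ n)) (hs _)).2.trans (hM' _)) hQ
      (hvm.neg.max measurable_const) (fun x => le_max_right _ _)
      (by filter_upwards [hae] with x hx using hx.neg.max tendsto_const_nhds) hr hc
  rcases hdich with h | h
  · refine hv0 (ae_eq_zero_of_integral_mul_eq_zero ?_ hpos hvGi hvG)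
    filter_upwards [hvs, measure_eq_zero_iff_ae_notMem.1 h] with x hx hx'
    by_cases hxΩ : x ∈ Ω
    · by_contra hneg
      refine hx' ⟨hxΩ, fun h0 => hneg ?_⟩
      simpa using h0
    · exact (hx hxΩ).ge
  · have : (fun x => -v x) =ᵐ[volume] 0 := by
      refine ae_eq_zero_of_integral_mul_eq_zero ?_ (by simpa using hpos)
        (by simpa using hvGi.neg) (by simpa [integral_neg] using hvG)
      filter_upwards [hvs, measure_eq_zero_iff_ae_notMem.1 h] with x hx hx'
      by_cases hxΩ : x ∈ Ω
      · by_contra hneg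
        refine hx' ⟨hxΩ, ?_⟩
        simp only [Pi.zero_apply, not_le, Left.neg_neg_iff] at hneg
        simpa using hneg.le
      · simp [hx hxΩ]
    refine hv0 ?_
    filter_upwards [this] with x hx
    simpa using hx

end Twisted

section Eigenvalues

variable {d : ℕ} {Ω : Set (EuclideanSpace ℝ (Fin d))} {g : EuclideanSpace ℝ (Fin d) → ℝ}

theorem rayleigh_nonneg (u : EuclideanSpace ℝ (Fin d) → ℝ) : 0 ≤ rayleigh d u :=
  div_nonneg (integral_nonneg fun x => by positivity) (integral_nonneg fun x => by positivity)

theorem dirichletEV_nonneg (Ω : Set (EuclideanSpace ℝ (Fin d))) : 0 ≤ dirichletEV d Ω :=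
  Real.sInf_nonneg (by rintro _ ⟨u, -, rfl⟩; exact rayleigh_nonneg u)

theorem integral_sq_pos_of_not_ae_eq_zero (hΩ : Bornology.IsBounded Ω) {K : NNReal}
    {u : EuclideanSpace ℝ (Fin d) → ℝ} (hu : LipschitzWith K u) (hs : ∀ x ∉ Ω, u x = 0)
    (h0 : ¬ u =ᵐ[volume] fun _ => (0 : ℝ)) : 0 < ∫ x, u x ^ 2 := by
  refine (integral_nonneg fun x => sq_nonneg _).lt_of_ne' fun h => h0 ?_
  filter_upwards [(integral_eq_zero_iff_of_nonneg (fun x => sq_nonneg (u x))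
    (hu.integrable_sq hΩ hs)).1 h] with x hx
  exact pow_eq_zero_iff two_ne_zero |>.1 hx

theorem dirichletEV_mul_integral_sq_le (hΩ : Bornology.IsBounded Ω) (K : NNReal)
    (f : EuclideanSpace ℝ (Fin d) → ℝ) (hf : LipschitzWith K f) (hs : ∀ x ∉ Ω, f x = 0) :
    dirichletEV d Ω * ∫ x, f x ^ 2 ≤ ∫ x, ‖gradient f x‖ ^ 2 := by
  by_cases h0 : f =ᵐ[volume] fun _ => (0 : ℝ)
  · have : ∫ x, f x ^ 2 = 0 := integral_eq_zero_of_ae (by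
      filter_upwards [h0] with x hx
      simp [hx])
    rw [this, mul_zero]
    exact integral_nonneg fun x => by positivity
  · rw [← le_div_iff₀ (integral_sq_pos_of_not_ae_eq_zero hΩ hf hs h0)]
    exact csInf_le ⟨0, by rintro _ ⟨u, -, rfl⟩; exact rayleigh_nonneg u⟩
      ⟨f, ⟨⟨K, hf⟩, hs, h0⟩, rfl⟩

theorem LipschitzWith.integrable_mul_of_ae_le_one (hΩ : Bornology.IsBounded Ω)
    (hgm : Measurable g) (hg : ∀ᵐ x, 0 < g x ∧ g x ≤ 1) {K : NNReal}
    {u : EuclideanSpace ℝ (Fin d) → ℝ} (hu : LipschitzWith K u) (hs : ∀ x ∉ Ω, u x = 0) :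
    Integrable fun x => u x * g x := by
  have hi : Integrable u volume :=
    hu.continuous.integrable_of_hasCompactSupport (hasCompactSupport_of_eq_zero hΩ hs)
  refine hi.mono (hu.continuous.measurable.mul hgm).aestronglyMeasurable ?_
  filter_upwards [hg] with x hx
  rw [norm_mul, Real.norm_of_nonneg hx.1.le]
  exact mul_le_of_le_one_right (norm_nonneg _) hx.2

theorem exists_bump_integral_mul_pos (hgm : Measurable g) (hg : ∀ᵐ x, 0 < g x ∧ g x ≤ 1)
    (c : EuclideanSpace ℝ (Fin d)) {r : ℝ} (hr : 0 < r) :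
    ∃ b : EuclideanSpace ℝ (Fin d) → ℝ, LipschitzWith 1 b ∧ (∀ x ∉ ball c r, b x = 0) ∧
      (∀ x ∈ ball c r, 0 < b x) ∧ 0 < ∫ x, b x * g x := by
  have hL : LipschitzWith 1 fun x : EuclideanSpace ℝ (Fin d) => max (r - dist x c) 0 := by
    refine LipschitzWith.max_const (LipschitzWith.of_le_add fun x y => ?_) 0
    linarith [dist_triangle_left y c x]
  have hz : ∀ x ∉ ball c r, max (r - dist x c) 0 = 0 := fun x hx =>
    max_eq_right (by simpa using hx)
  have hp : ∀ x ∈ ball c r, 0 < max (r - dist x c) 0 := fun x hx =>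
    lt_max_of_lt_left (by simpa using hx)
  refine ⟨_, hL, hz, hp, ?_⟩
  have hi := hL.integrable_mul_of_ae_le_one isBounded_ball hgm hg hz
  have h0 : ∀ᵐ x, 0 ≤ max (r - dist x c) 0 * g x := by
    filter_upwards [hg] with x hx
    exact mul_nonneg (le_max_right _ _) hx.1.le
  refine (integral_nonneg_of_ae h0).lt_of_ne' fun h => ?_
  refine (measure_ball_pos volume c hr).ne' (measure_eq_zero_iff_ae_notMem.2 ?_)
  filter_upwards [(integral_eq_zero_iff_of_nonneg_ae h0 hi).1 h, hg] with x hx hx' hxB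
  exact (mul_pos (hp x hxB) hx'.1).ne' hx

theorem exists_isDirTrial_integral_mul_eq_zero [Nontrivial (EuclideanSpace ℝ (Fin d))]
    (hΩo : IsOpen Ω) (hne : Ω.Nonempty) (hgm : Measurable g) (hg : ∀ᵐ x, 0 < g x ∧ g x ≤ 1) :
    ∃ u, IsDirTrial d Ω u ∧ ∫ x, u x * g x = 0 := by
  obtain ⟨x, hx⟩ := hne
  obtain ⟨r, hr, hxr⟩ := Metric.isOpen_iff.1 hΩo x hx
  obtain ⟨w, hw⟩ := exists_norm_eq (EuclideanSpace ℝ (Fin d)) (half_pos hr).le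
  have hr4 : 0 < r / 4 := by positivity
  have hdist : dist x (x + w) = r / 2 := by simp [hw]
  have hB : ball x (r / 4) ⊆ Ω := (ball_subset_ball (by linarith)).trans hxr
  have hB' : ball (x + w) (r / 4) ⊆ Ω :=
    (ball_subset_ball' (by rw [dist_comm, hdist]; linarith)).trans hxr
  have hdisj : Disjoint (ball x (r / 4)) (ball (x + w) (r / 4)) :=
    ball_disjoint_ball (by rw [hdist]; linarith)
  obtain ⟨b, hb, hbz, hbp, hbi⟩ := exists_bump_integral_mul_pos hgm hg x hr4
  obtain ⟨b', hb', hbz', -, hbi'⟩ := exists_bump_integral_mul_pos hgm hg (x + w) hr4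
  have hi := hb.integrable_mul_of_ae_le_one isBounded_ball hgm hg hbz
  have hi' := hb'.integrable_mul_of_ae_le_one isBounded_ball hgm hg hbz'
  set p := ∫ x, b x * g x with hpdef
  set q := ∫ x, b' x * g x with hqdef
  refine ⟨fun y => q * b y - p * b' y, ⟨⟨_, ((lipschitzWith_smul q).comp hb).sub
    ((lipschitzWith_smul p).comp hb')⟩, fun y hy => ?_, fun h => ?_⟩, ?_⟩
  · simp [hbz y fun h => hy (hB h), hbz' y fun h => hy (hB' h)]
  · refine (measure_ball_pos volume x hr4).ne' (measure_eq_zero_iff_ae_notMem.2 ?_)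
    filter_upwards [h] with y hy hyB
    rw [hbz' y (disjoint_left.1 hdisj hyB), mul_zero, sub_zero] at hy
    exact (mul_pos hbi' (hbp y hyB)).ne' hy
  · have : ∀ y, (q * b y - p * b' y) * g y = q * (b y * g y) - p * (b' y * g y) :=
      fun y => by ring
    simp only [this]
    rw [integral_sub (hi.const_mul q) (hi'.const_mul p), integral_const_mul, integral_const_mul,
      ← hpdef, ← hqdef, mul_comm, sub_self]

theorem exists_normalized_trial (hΩ : Bornology.IsBounded Ω)
    {u : EuclideanSpace ℝ (Fin d) → ℝ} (hu : IsDirTrial d Ω u) (h0 : ∫ x, u x * g x = 0) :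
    ∃ (K : NNReal) (w : EuclideanSpace ℝ (Fin d) → ℝ), LipschitzWith K w ∧
      (∀ x ∉ Ω, w x = 0) ∧ ∫ x, w x ^ 2 = 1 ∧ ∫ x, w x * g x = 0 ∧
      ∫ x, ‖gradient w x‖ ^ 2 = rayleigh d u := by
  obtain ⟨⟨K, hK⟩, hs, hne⟩ := hu
  have hpos := integral_sq_pos_of_not_ae_eq_zero hΩ hK hs hne
  set m := ∫ x, u x ^ 2 with hm
  have hc : (√m)⁻¹ ^ 2 = m⁻¹ := by rw [inv_pow, Real.sq_sqrt hpos.le]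
  refine ⟨_, fun x => (√m)⁻¹ * u x, (lipschitzWith_smul (√m)⁻¹).comp hK, fun x hx => ?_, ?_, ?_, ?_⟩
  · simp [hs x hx]
  · simp only [mul_pow]
    rw [integral_const_mul, hc, ← hm, inv_mul_cancel₀ hpos.ne']
  · simp only [mul_assoc]
    rw [integral_const_mul, h0, mul_zero]
  · rw [rayleigh, ← hm, div_eq_inv_mul, ← integral_const_mul]
    refine integral_congr_ae ?_
    filter_upwards [hK.ae_differentiableAt] with x hx
    rw [gradient_fun_const_mul' hx, norm_smul, mul_pow, Real.norm_eq_abs, sq_abs, hc]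

end Eigenvalues

/-- on a connected set, `λ₁^g(Ω) > λ₁(Ω)` for every `g ∈ L^∞₊`. -/
theorem stmt2 (d : ℕ) (hd : 2 ≤ d) (Ω : Set (EuclideanSpace ℝ (Fin d)))
    (hΩo : IsOpen Ω) (hΩb : Bornology.IsBounded Ω) (hΩc : IsConnected Ω)
    (g : EuclideanSpace ℝ (Fin d) → ℝ) (hgm : Measurable g)
    (hg : ∀ᵐ x, 0 < g x ∧ g x ≤ 1) :
    dirichletEV d Ω < twistedEV d Ω g := by
  have : Nonempty (Fin d) := ⟨⟨0, by omega⟩⟩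
  by_contra! hle
  obtain ⟨u₀, hu₀, h₀⟩ := exists_isDirTrial_integral_mul_eq_zero hΩo hΩc.nonempty hgm hg
  have hex : ∀ n : ℕ, ∃ (K : NNReal) (w : EuclideanSpace ℝ (Fin d) → ℝ), LipschitzWith K w ∧
      (∀ x ∉ Ω, w x = 0) ∧ ∫ x, w x ^ 2 = 1 ∧ ∫ x, w x * g x = 0 ∧
      ∫ x, ‖gradient w x‖ ^ 2 ≤ dirichletEV d Ω + 1 / ((n : ℝ) + 1) := fun n => by
    have hn : (0 : ℝ) < 1 / ((n : ℝ) + 1) := by positivity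
    obtain ⟨_, ⟨u, hu, h0, rfl⟩, hlt⟩ := exists_lt_of_csInf_lt
      (s := {r | ∃ u, IsDirTrial d Ω u ∧ (∫ x, u x * g x) = 0 ∧ rayleigh d u = r})
      ⟨_, u₀, hu₀, h₀, rfl⟩ (lt_of_le_of_lt hle (lt_add_of_pos_right _ hn))
    obtain ⟨K, w, hw, hs, h1, h2, h3⟩ := exists_normalized_trial hΩb hu h0
    exact ⟨K, w, hw, hs, h1, h2, h3.trans_le hlt.le⟩
  choose K u hu hs h1 horth hE using hex
  have hl := dirichletEV_mul_integral_sq_le hΩb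
  refine not_minimizing_of_integral_mul_eq_zero hΩo hΩb hΩc.isPreconnected hgm hg
    (dirichletEV_nonneg Ω) hl hu hs h1 horth
    (tendsto_of_tendsto_of_tendsto_of_le_of_le tendsto_const_nhds ?_ (fun n => ?_) hE)
  · simpa using tendsto_one_div_add_atTop_nhds_zero_nat.const_add (dirichletEV d Ω)
  · simpa [h1] using hl _ _ (hu n) (hs n)
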